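/- There exist δ_2 ∈ (0,δ_1) and c_2 > 0 such that for all λ ∈ [−δ_2,δ_2], ω ∈ [1−δ_2,1+δ_2], and u ∈ C_n with ‖u‖_∞ ≤ δ_2, one has ‖(I − P)(I − C(λ,ω) − ∂_uF(λ,ω,u))w‖_∞ ≥ c_2 ‖w‖_∞ for all w ∈ ker Q. -/

import Mathlib

open Real Set MeasureTheory Filter Topology

noncomputable section

instance fact_two_pi_pos : Fact (0 < 2 * Real.pi) := ⟨by positivity⟩

/-- The time circle of length `2π` (continuous `2π`-time-periodic functions of `t ∈ ℝ`
are identified with continuous functions on this circle). -/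
abbrev TimeCircle : Type := AddCircle (2 * Real.pi)

/-- The domain `[0,1] × (ℝ / 2πℤ)`. -/
abbrev Dom : Type := Set.Icc (0:ℝ) 1 × TimeCircle

/-- The Banach space `C_n` of continuous `2π`-time-periodic maps `u : [0,1] × ℝ → ℝⁿ`
with the sup-norm, realized as the space of continuous maps on the compact set `Dom`. -/
abbrev Cspace (n : ℕ) : Type := C(Dom, Fin n → ℝ)

/-- Evaluation of an element of `Cspace n` at real coordinates `(x,t)`
(extended constantly outside `[0,1]` in the `x`-variable). -/
def ev {n : ℕ} (u : Cspace n) (x t : ℝ) : Fin n → ℝ :=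
  u (Set.projIcc (0:ℝ) 1 zero_le_one x, (t : TimeCircle))

/-- The boundary point `x_j`: `0` for `j = 1,…,m` and `1` for `j = m+1,…,n`
(with 0-based indices: `0` for `j < m`, `1` for `j ≥ m`). -/
def xjv (m : ℕ) {n : ℕ} (j : Fin n) : ℝ := if (j : ℕ) < m then 0 else 1

/-- The data of the problem: coefficients `a_j(x,λ)`, nonlinearities `b_j(x,λ,u)`
and reflection coefficients `r_{jk}`, for a system of `n` equations with `m`
components running to the right. -/
structure HypData (n m : ℕ) where
  a : Fin n → ℝ → ℝ → ℝ
  b : Fin n → ℝ → ℝ → (Fin n → ℝ) → ℝ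
  r : Fin n → Fin n → ℝ

namespace HypData

variable {n m : ℕ} (d : HypData n m)

/-- `∂_{u_k} b_j (x, λ, 0)`. -/
def dbu (j k : Fin n) (x lam : ℝ) : ℝ := fderiv ℝ (d.b j x lam) 0 (Pi.single k 1)

/-- `∂²_{u_k u_l} b_j (x, λ, 0)`. -/
def dbu2 (j k l : Fin n) (x lam : ℝ) : ℝ :=
  fderiv ℝ (fun v => fderiv ℝ (d.b j x lam) v (Pi.single l 1)) 0 (Pi.single k 1)

/-- `∂³_{u_k u_l u_r} b_j (x, λ, 0)`. -/
def dbu3 (j k l rr : Fin n) (x lam : ℝ) : ℝ :=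
  fderiv ℝ (fun v =>
    fderiv ℝ (fun v' => fderiv ℝ (d.b j x lam) v' (Pi.single rr 1)) v (Pi.single l 1))
    0 (Pi.single k 1)

/-- The characteristic `τ_j(ξ,x,t,λ,ω) = ω ∫_x^ξ dη / a_j(η,λ) + t`. -/
def tau (j : Fin n) (ξ x t lam ω : ℝ) : ℝ := ω * (∫ η in x..ξ, (d.a j η lam)⁻¹) + t

/-- The weight `c_j(ξ,x,λ) = exp ∫_x^ξ ∂_{u_j}b_j(η,λ,0) / a_j(η,λ) dη`. -/
def cfac (j : Fin n) (ξ x lam : ℝ) : ℝ :=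
  Real.exp (∫ η in x..ξ, d.dbu j j η lam / d.a j η lam)

/-- `f_j(x,λ,u) = ∂_{u_j}b_j(x,λ,0) u_j − b_j(x,λ,u)`. -/
def ffun (j : Fin n) (x lam : ℝ) (u : Fin n → ℝ) : ℝ := d.dbu j j x lam * u j - d.b j x lam u

/-- The operator `C(λ,ω)` acting on (representations of) functions. -/
def CopRaw (lam ω : ℝ) (U : ℝ → ℝ → Fin n → ℝ) (x t : ℝ) (j : Fin n) : ℝ :=
  if (j : ℕ) < m then
    d.cfac j 0 x lam *
      ∑ k : Fin n, (if m ≤ (k : ℕ) then d.r j k * U 0 (d.tau j 0 x t lam ω) k else 0)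
  else
    d.cfac j 1 x lam *
      ∑ k : Fin n, (if (k : ℕ) < m then d.r j k * U 1 (d.tau j 1 x t lam ω) k else 0)

/-- The operator `F(λ,ω,·)` acting on (representations of) functions. -/
def FopRaw (lam ω : ℝ) (U : ℝ → ℝ → Fin n → ℝ) (x t : ℝ) (j : Fin n) : ℝ :=
  ∫ ξ in (xjv m j)..x,
    (d.cfac j ξ x lam / d.a j ξ lam) * d.ffun j ξ lam (U ξ (d.tau j ξ x t lam ω))

/-- The operator `D(λ,ω)`. -/
def DopRaw (lam ω : ℝ) (U : ℝ → ℝ → Fin n → ℝ) (x t : ℝ) (j : Fin n) : ℝ :=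
  ∫ ξ in (xjv m j)..x,
    (d.cfac j ξ x lam / d.a j ξ lam) * U ξ (d.tau j ξ x t lam ω) j

/-- The Fréchet derivative `∂_u F(λ,ω,0)` (explicit formula). -/
def dFRaw (lam ω : ℝ) (U : ℝ → ℝ → Fin n → ℝ) (x t : ℝ) (j : Fin n) : ℝ :=
  -∫ ξ in (xjv m j)..x,
    (d.cfac j ξ x lam / d.a j ξ lam) *
      ∑ k : Fin n, (if k ≠ j then d.dbu j k ξ lam * U ξ (d.tau j ξ x t lam ω) k else 0)

end HypData

/-- Partial derivative in `x` (within `[0,1]`). -/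
def pdx {n : ℕ} (U : ℝ → ℝ → Fin n → ℝ) (x t : ℝ) (j : Fin n) : ℝ :=
  derivWithin (fun y => U y t j) (Set.Icc 0 1) x

/-- Partial derivative in `t`. -/
def pdt {n : ℕ} (U : ℝ → ℝ → Fin n → ℝ) (x t : ℝ) (j : Fin n) : ℝ :=
  deriv (fun s => U x s j) t

/-- `U` represents an element of `C_n`: continuous on `[0,1] × ℝ` and `2π`-periodic in time. -/
def IsCnFun {n : ℕ} (U : ℝ → ℝ → Fin n → ℝ) : Prop :=
  ContinuousOn (fun p : ℝ × ℝ => U p.1 p.2) (Set.Icc 0 1 ×ˢ Set.univ) ∧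
  ∀ x t, U x (t + 2 * Real.pi) = U x t

/-- `U` represents an element of `C_n^1`: it is in `C_n` and has continuous
partial derivatives `∂_x U`, `∂_t U` on `[0,1] × ℝ`. -/
def IsCn1Fun {n : ℕ} (U : ℝ → ℝ → Fin n → ℝ) : Prop :=
  IsCnFun U ∧
  (∀ (j : Fin n) (t : ℝ), ∀ x ∈ Set.Icc (0:ℝ) 1,
      DifferentiableWithinAt ℝ (fun y => U y t j) (Set.Icc 0 1) x ∧
      DifferentiableAt ℝ (fun s => U x s j) t) ∧
  ContinuousOn (fun p : ℝ × ℝ => pdx U p.1 p.2) (Set.Icc 0 1 ×ˢ Set.univ) ∧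
  ContinuousOn (fun p : ℝ × ℝ => pdt U p.1 p.2) (Set.Icc 0 1 ×ˢ Set.univ)

/-- The sup-norm `‖U‖_∞ = sup { |U_j(x,t)| : x ∈ [0,1], t ∈ ℝ, j }`. -/
def supNorm {n : ℕ} (U : ℝ → ℝ → Fin n → ℝ) : ℝ :=
  sSup {y : ℝ | ∃ x ∈ Set.Icc (0:ℝ) 1, ∃ t : ℝ, ∃ j : Fin n, y = |U x t j|}

/-- The `C¹`-norm `‖U‖_∞ + ‖∂_x U‖_∞ + ‖∂_t U‖_∞`. -/
def c1Norm {n : ℕ} (U : ℝ → ℝ → Fin n → ℝ) : ℝ :=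
  supNorm U + supNorm (pdx U) + supNorm (pdt U)

/-- The `L²`-type pairing `⟨u,v⟩ = (1/2π) Σ_j ∫_0^{2π} ∫_0^1 u_j v_j dx dt`. -/
def pairing {n : ℕ} (U V : ℝ → ℝ → Fin n → ℝ) : ℝ :=
  (1 / (2 * Real.pi)) *
    ∑ j : Fin n, ∫ t in (0:ℝ)..(2 * Real.pi), ∫ x in (0:ℝ)..1, U x t j * V x t j

/-- The Hermitian pairing `⟨u,v⟩ = (1/2π) Σ_j ∫_0^{2π} ∫_0^1 u_j conj(v_j) dx dt`. -/
def pairingC {n : ℕ} (U : ℝ → ℝ → Fin n → ℝ) (V : ℝ → ℝ → Fin n → ℂ) : ℂ :=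
  (1 / (2 * Real.pi) : ℂ) *
    ∑ j : Fin n, ∫ t in (0:ℝ)..(2 * Real.pi), ∫ x in (0:ℝ)..1,
      (U x t j : ℂ) * starRingEnd ℂ (V x t j)

/-- The real part of the wave `v(x) e^{-it}`. -/
def reWave {n : ℕ} (v : Fin n → ℝ → ℂ) (x t : ℝ) (j : Fin n) : ℝ :=
  (v j x * Complex.exp (-(Complex.I * t))).re

/-- The imaginary part of the wave `v(x) e^{-it}`. -/
def imWave {n : ℕ} (v : Fin n → ℝ → ℂ) (x t : ℝ) (j : Fin n) : ℝ :=
  (v j x * Complex.exp (-(Complex.I * t))).im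

/-- A family of complex functions on `[0,1]` is nontrivial. -/
def Nontriv {n : ℕ} (v : Fin n → ℝ → ℂ) : Prop := ∃ j : Fin n, ∃ x ∈ Set.Icc (0:ℝ) 1, v j x ≠ 0

/-- The time shift operator `(S_φ u)(x,t) = u(x, t+φ)` on `Cspace n`. -/
def Sshift {n : ℕ} (φ : ℝ) (u : Cspace n) : Cspace n :=
  u.comp ⟨fun p => (p.1, p.2 + (φ : TimeCircle)), by continuity⟩

namespace HypData

variable {n m : ℕ} (d : HypData n m)

/-- The differential operator `A(λ,ω)`. -/
def AopRaw (lam ω : ℝ) (U : ℝ → ℝ → Fin n → ℝ) (x t : ℝ) (j : Fin n) : ℝ :=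
  ω * pdt U x t j + d.a j x lam * pdx U x t j + d.dbu j j x lam * U x t j

/-- The formally adjoint differential operator `Ã(λ,ω)`. -/
def AtilRaw (lam ω : ℝ) (U : ℝ → ℝ → Fin n → ℝ) (x t : ℝ) (j : Fin n) : ℝ :=
  -(ω * pdt U x t j) - derivWithin (fun y => d.a j y lam * U y t j) (Set.Icc 0 1) x +
    d.dbu j j x lam * U x t j

/-- The complex version of `Ã(λ,ω)` acting on complex-valued functions. -/
def AtilRawC (lam ω : ℝ) (W : ℝ → ℝ → Fin n → ℂ) (x t : ℝ) (j : Fin n) : ℂ :=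
  -((ω : ℂ) * deriv (fun s => W x s j) t) -
    derivWithin (fun y => (d.a j y lam : ℂ) * W y t j) (Set.Icc 0 1) x +
    (d.dbu j j x lam : ℂ) * W x t j

/-- The off-diagonal multiplication operator `B(λ)`. -/
def BopRaw (lam : ℝ) (U : ℝ → ℝ → Fin n → ℝ) (x t : ℝ) (j : Fin n) : ℝ :=
  ∑ k : Fin n, (if k ≠ j then d.dbu j k x lam * U x t k else 0)

/-- The reflection boundary conditions. -/
def SatBC (U : ℝ → ℝ → Fin n → ℝ) : Prop :=
  ∀ (t : ℝ) (j : Fin n),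
    ((j : ℕ) < m → U 0 t j = ∑ k : Fin n, (if m ≤ (k : ℕ) then d.r j k * U 0 t k else 0)) ∧
    (m ≤ (j : ℕ) → U 1 t j = ∑ k : Fin n, (if (k : ℕ) < m then d.r j k * U 1 t k else 0))

/-- The adjoint boundary conditions. -/
def SatAdjBC (lam : ℝ) (V : ℝ → ℝ → Fin n → ℝ) : Prop :=
  ∀ (t : ℝ) (j : Fin n),
    (m ≤ (j : ℕ) → d.a j 0 lam * V 0 t j
        = -∑ k : Fin n, (if (k : ℕ) < m then d.r k j * d.a k 0 lam * V 0 t k else 0)) ∧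
    ((j : ℕ) < m → d.a j 1 lam * V 1 t j
        = -∑ k : Fin n, (if m ≤ (k : ℕ) then d.r k j * d.a k 1 lam * V 1 t k else 0))

/-- `U` is a classical (`C¹`, `2π`-time-periodic) solution of the hyperbolic system
`ω ∂_t u_j + a_j(x,λ) ∂_x u_j + b_j(x,λ,u) = 0` with the reflection boundary conditions. -/
def IsClassicalSolution (lam ω : ℝ) (U : ℝ → ℝ → Fin n → ℝ) : Prop :=
  IsCn1Fun U ∧
  (∀ x ∈ Set.Ioo (0:ℝ) 1, ∀ (t : ℝ) (j : Fin n),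
      ω * pdt U x t j + d.a j x lam * pdx U x t j + d.b j x lam (U x t) = 0) ∧
  d.SatBC U

/-- The standing assumptions: `1 ≤ m ≤ n`, smoothness of the coefficients, hyperbolicity
`a_j(x,0) ≠ 0`, nondegeneracy `a_j(x,0) ≠ a_k(x,0)` for `j ≠ k`, the trivial solution
assumption `b_j(x,λ,0) = 0`, and nonvanishing of `a_j(x,λ)` for `|λ| ≤ δ₀`. -/
def StandingHyps (δ0 : ℝ) : Prop :=
  1 ≤ m ∧ m ≤ n ∧
  (∀ j, ContDiff ℝ (⊤ : ℕ∞) (fun p : ℝ × ℝ => d.a j p.1 p.2)) ∧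
  (∀ j, ContDiff ℝ (⊤ : ℕ∞) (fun p : ℝ × ℝ × (Fin n → ℝ) => d.b j p.1 p.2.1 p.2.2)) ∧
  (∀ j, ∀ x ∈ Set.Icc (0:ℝ) 1, d.a j x 0 ≠ 0) ∧
  (∀ j k, j ≠ k → ∀ x ∈ Set.Icc (0:ℝ) 1, d.a j x 0 ≠ d.a k x 0) ∧
  (∀ j x lam, d.b j x lam 0 = 0) ∧
  0 < δ0 ∧
  (∀ j, ∀ x ∈ Set.Icc (0:ℝ) 1, ∀ lam ∈ Set.Icc (-δ0) δ0, d.a j x lam ≠ 0)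

/-- The constant `R₀(λ)`. -/
def R0lam (lam : ℝ) : ℝ :=
  sSup {y : ℝ | ∃ j : Fin n, (j : ℕ) < m ∧ ∃ x ∈ Set.Icc (0:ℝ) 1,
    y = ∑ k : Fin n, (if m ≤ (k : ℕ) then
          |d.r j k| * Real.exp (-∫ η in (0:ℝ)..x, d.dbu j j η lam / d.a j η lam) else 0)}

/-- The constant `R₁(λ)`. -/
def R1lam (lam : ℝ) : ℝ :=
  sSup {y : ℝ | ∃ j : Fin n, m ≤ (j : ℕ) ∧ ∃ x ∈ Set.Icc (0:ℝ) 1,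
    y = ∑ k : Fin n, (if (k : ℕ) < m then
          |d.r j k| * Real.exp (∫ η in x..(1:ℝ), d.dbu j j η lam / d.a j η lam) else 0)}

/-- `R₀ = R₀(0)`. -/
def R0c : ℝ := d.R0lam 0

/-- `R₁ = R₁(0)`. -/
def R1c : ℝ := d.R1lam 0

/-- `v` solves the eigenvalue problem (EV) with parameters `λ`, `μ`. -/
def IsEV (lam : ℝ) (mu : ℂ) (v : Fin n → ℝ → ℂ) : Prop :=
  (∀ (j : Fin n), ∀ x ∈ Set.Icc (0:ℝ) 1, ∃ dv : ℂ,
      HasDerivWithinAt (v j) dv (Set.Icc 0 1) x ∧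
      (d.a j x lam : ℂ) * dv + ∑ k : Fin n, (d.dbu j k x lam : ℂ) * v k x = mu * v j x) ∧
  (∀ j : Fin n, (j : ℕ) < m →
      v j 0 = ∑ k : Fin n, (if m ≤ (k : ℕ) then (d.r j k : ℂ) * v k 0 else 0)) ∧
  (∀ j : Fin n, m ≤ (j : ℕ) →
      v j 1 = ∑ k : Fin n, (if (k : ℕ) < m then (d.r j k : ℂ) * v k 1 else 0))

/-- `w` solves the adjoint eigenvalue problem (AEV) with parameters `λ`, `ν`. -/
def IsAEV (lam : ℝ) (nu : ℂ) (w : Fin n → ℝ → ℂ) : Prop :=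
  (∀ (j : Fin n), ∀ x ∈ Set.Icc (0:ℝ) 1, ∃ dw : ℂ,
      HasDerivWithinAt (fun y => (d.a j y lam : ℂ) * w j y) dw (Set.Icc 0 1) x ∧
      -dw + ∑ k : Fin n, (d.dbu k j x lam : ℂ) * w k x = nu * w j x) ∧
  (∀ j : Fin n, m ≤ (j : ℕ) →
      (d.a j 0 lam : ℂ) * w j 0
        = -∑ k : Fin n, (if (k : ℕ) < m then (d.r k j : ℂ) * (d.a k 0 lam : ℂ) * w k 0 else 0)) ∧
  (∀ j : Fin n, (j : ℕ) < m →
      (d.a j 1 lam : ℂ) * w j 1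
        = -∑ k : Fin n, (if m ≤ (k : ℕ) then (d.r k j : ℂ) * (d.a k 1 lam : ℂ) * w k 1 else 0))

/-- Assumption (H1): for `λ = 0`, `μ = i` the eigenvalue problem has exactly one
nontrivial solution up to linear dependence. -/
def HypH1 : Prop :=
  ∃ v, d.IsEV 0 Complex.I v ∧ Nontriv v ∧
    ∀ v', d.IsEV 0 Complex.I v' → ∃ c : ℂ, ∀ (j : Fin n), ∀ x ∈ Set.Icc (0:ℝ) 1, v' j x = c * v j x

/-- Assumption (H2): algebraic simplicity. -/
def HypH2 : Prop :=
  ∀ v w, d.IsEV 0 Complex.I v → Nontriv v → d.IsAEV 0 (-Complex.I) w → Nontriv w →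
    (∑ j : Fin n, ∫ x in (0:ℝ)..1, v j x * starRingEnd ℂ (w j x)) ≠ 0

/-- Assumption (H4): nonresonance. -/
def HypH4 : Prop :=
  ∀ k : ℤ, (∃ v, d.IsEV 0 (Complex.I * k) v ∧ Nontriv v) → k = 1 ∨ k = -1

end HypData

/-- Normalization `Σ_j ∫_0^1 v⁰_j conj(w⁰_j) dx = 2`. -/
def NormalizedPair {n : ℕ} (v0 w0 : Fin n → ℝ → ℂ) : Prop :=
  (∑ j : Fin n, ∫ x in (0:ℝ)..1, v0 j x * starRingEnd ℂ (w0 j x)) = 2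

/-- The transversality quantity `α`. -/
def alphaVal {n m : ℕ} (d : HypData n m) (v0 v0' w0 : Fin n → ℝ → ℂ) : ℝ :=
  (1/2) * (∑ j : Fin n, ∫ x in (0:ℝ)..1,
    ((deriv (fun lam => d.a j x lam) 0 : ℂ) * v0' j x
      + ∑ k : Fin n, (deriv (fun lam => d.dbu j k x lam) 0 : ℂ) * v0 k x)
      * starRingEnd ℂ (w0 j x)).re

/-- The bifurcation-direction quantity `β`. -/
def betaVal {n m : ℕ} (d : HypData n m) (v0 w0 y z : Fin n → ℝ → ℂ) : ℝ :=
  -(∫ x in (0:ℝ)..1,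
      ((1/8 : ℂ) * ∑ j : Fin n, ∑ k : Fin n, ∑ l : Fin n, ∑ rr : Fin n,
          (d.dbu3 j k l rr x 0 : ℂ) * v0 k x * v0 l x *
            starRingEnd ℂ (v0 rr x) * starRingEnd ℂ (w0 j x)
        + ∑ j : Fin n, ∑ k : Fin n, ∑ l : Fin n,
          (d.dbu2 j k l x 0 : ℂ) * (y k x * starRingEnd ℂ (v0 l x) + z k x * v0 l x) *
            starRingEnd ℂ (w0 j x))).re

end

/-- If `x = C x + F z` always has a solution with control of the norm, and `F (C y + F z)` ranges
in compact sets, then a projection vanishing on the range of `I - C - F` maps bounded sequences in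
its range to sequences with convergent subsequences. -/
theorem exists_tendsto_subseq_of_projection {E : Type*} [NormedAddCommGroup E] [NormedSpace ℝ E]
    {C F P : E →L[ℝ] E} {M : ℝ} (hM0 : 0 ≤ M) (hM : ∀ z, ‖z‖ ≤ M * ‖z - C z‖)
    (hsurj : ∀ h, ∃ z, z - C z = h)
    (hcpt : ∀ R : ℝ, ∃ S : Set E, IsCompact S ∧
      ∀ y z, ‖z‖ ≤ R → ‖C y + F z‖ ≤ R → F (C y + F z) ∈ S)
    (hP : ∀ z, P (z - C z - F z) = 0)
    {p : ℕ → E} (hp : ∀ k, P (p k) = p k) {R : ℝ} (hR : ∀ k, ‖p k‖ ≤ R) :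
    ∃ q, ∃ φ : ℕ → ℕ, StrictMono φ ∧ Tendsto (p ∘ φ) atTop (𝓝 q) := by
  choose z hz using fun k => hsurj (p k)
  choose y hy using fun k => hsurj (F (z k))
  have hzR : ∀ k, ‖z k‖ ≤ M * R := fun k => by
    refine (hM (z k)).trans ?_
    rw [hz]
    exact mul_le_mul_of_nonneg_left (hR k) hM0
  have hyR : ∀ k, ‖y k‖ ≤ M * (‖F‖ * (M * R)) := fun k => by
    refine (hM (y k)).trans ?_
    rw [hy]
    refine mul_le_mul_of_nonneg_left ((F.le_opNorm _).trans ?_) hM0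
    exact mul_le_mul_of_nonneg_left (hzR k) (norm_nonneg _)
  have hyz : ∀ k, C (y k) + F (z k) = y k := fun k => by rw [← hy k]; abel
  obtain ⟨S, hS, hmem⟩ := hcpt (max (M * R) (M * (‖F‖ * (M * R))))
  have hpk : ∀ k, p k = P (F (C (y k) + F (z k))) := fun k => by
    have e1 := hP (z k)
    have e3 := hyz k
    have e2 := hP (y k)
    rw [map_sub, sub_eq_zero] at e1 e2
    rw [e3, ← e2, hy k, ← e1, hz k, hp k]
  obtain ⟨s, -, φ, hφ, hlim⟩ := hS.tendsto_subseq
    (fun k => hmem (y k) (z k) ((hzR k).trans (le_max_left _ _))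
      ((hyz k).symm ▸ (hyR k).trans (le_max_right _ _)))
  refine ⟨P s, φ, hφ, ?_⟩
  have := (P.continuous.tendsto s).comp hlim
  refine this.congr fun k => ?_
  simp [hpk (φ k)]

/-- Uniformly bounded operators converging strongly may be applied to convergent sequences. -/
theorem tendsto_apply_of_strong {E : Type*} [NormedAddCommGroup E] [NormedSpace ℝ E]
    [CompleteSpace E] {T : ℕ → E →L[ℝ] E} {T0 : E →L[ℝ] E}
    (hT : ∀ z, Tendsto (fun k => T k z) atTop (𝓝 (T0 z))) {x : ℕ → E} {x0 : E}
    (hx : Tendsto x atTop (𝓝 x0)) : Tendsto (fun k => T k (x k)) atTop (𝓝 (T0 x0)) := by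
  obtain ⟨K, hK⟩ : ∃ K, ∀ k, ‖T k‖ ≤ K := banach_steinhaus fun z => by
    obtain ⟨K, hK⟩ := (hT z).norm.bddAbove_range
    exact ⟨K, fun k => hK ⟨k, rfl⟩⟩
  have h1 : Tendsto (fun k => T k (x k - x0)) atTop (𝓝 0) := by
    refine squeeze_zero_norm (a := fun k => K * ‖x k - x0‖) (fun k => ?_) ?_
    · exact ((T k).le_opNorm _).trans (mul_le_mul_of_nonneg_right (hK k) (norm_nonneg _))
    · have : Tendsto (fun k => x k - x0) atTop (𝓝 0) := by
        simpa using hx.sub_const x0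
      simpa using this.norm.const_mul K
  simpa using h1.add (hT x0)

/-- The compactness argument behind the uniform lower bound: no normalized sequence in `ker Q` can
be asymptotically annihilated by `(I - P)(I - C_k - E_k)`. -/
theorem false_of_asymptotic_kernel {E : Type*} [NormedAddCommGroup E] [NormedSpace ℝ E]
    [CompleteSpace E] {C F D : ℕ → E →L[ℝ] E} {C0 F0 P Q : E →L[ℝ] E}
    (hC : ∀ z, Tendsto (fun k => C k z) atTop (𝓝 (C0 z)))
    (hF : ∀ z, Tendsto (fun k => F k z) atTop (𝓝 (F0 z)))
    (hD : Tendsto (fun k => ‖D k - F k‖) atTop (𝓝 0))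
    {M : ℝ} (hM0 : 0 ≤ M) (hM : ∀ k z, ‖z‖ ≤ M * ‖z - C k z‖)
    (hsurj : ∀ h, ∃ z, z - C0 z = h)
    (hcpt : ∀ R : ℝ, ∃ S : Set E, IsCompact S ∧
      ∀ k y z, ‖z‖ ≤ R → ‖C k y + F k z‖ ≤ R → F k (C k y + F k z) ∈ S)
    (hcpt0 : ∀ R : ℝ, ∃ S : Set E, IsCompact S ∧
      ∀ y z, ‖z‖ ≤ R → ‖C0 y + F0 z‖ ≤ R → F0 (C0 y + F0 z) ∈ S)
    (hPP : ∀ z, P (P z) = P z) (hQQ : ∀ z, Q (Q z) = Q z)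
    (hP : ∀ z, P (z - C0 z - F0 z) = 0)
    (hQ : ∀ z, z - C0 z - F0 z = 0 → ∃ y, Q y = z)
    {w : ℕ → E} (hw : ∀ k, ‖w k‖ = 1) (hwQ : ∀ k, Q (w k) = 0)
    (hlim : Tendsto (fun k => (w k - C k (w k) - D k (w k)) -
      P (w k - C k (w k) - D k (w k))) atTop (𝓝 0)) : False := by
  have hM' : ∀ z, ‖z‖ ≤ M * ‖z - C0 z‖ := fun z =>
    ge_of_tendsto (((tendsto_const_nhds.sub (hC z)).norm).const_mul M)
      (Eventually.of_forall fun k => hM k z)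
  -- uniform bounds
  obtain ⟨KC, hKC⟩ : ∃ K, ∀ k, ‖C k‖ ≤ K := banach_steinhaus fun z => by
    obtain ⟨K, hK⟩ := (hC z).norm.bddAbove_range
    exact ⟨K, fun k => hK ⟨k, rfl⟩⟩
  obtain ⟨KF, hKF⟩ : ∃ K, ∀ k, ‖F k‖ ≤ K := banach_steinhaus fun z => by
    obtain ⟨K, hK⟩ := (hF z).norm.bddAbove_range
    exact ⟨K, fun k => hK ⟨k, rfl⟩⟩
  obtain ⟨KD, hKD⟩ := hD.bddAbove_range
  have hCw : ∀ k, ‖C k (w k)‖ ≤ KC := fun k => by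
    simpa [hw k] using ((C k).le_opNorm (w k)).trans
      (mul_le_mul_of_nonneg_right (hKC k) (norm_nonneg _))
  have hFw : ∀ k, ‖F k (w k)‖ ≤ KF := fun k => by
    simpa [hw k] using ((F k).le_opNorm (w k)).trans
      (mul_le_mul_of_nonneg_right (hKF k) (norm_nonneg _))
  have hDFw : ∀ k, ‖(D k - F k) (w k)‖ ≤ ‖D k - F k‖ := fun k => by
    simpa [hw k] using (D k - F k).le_opNorm (w k)
  have hDw : ∀ k, ‖D k (w k)‖ ≤ KD + KF := fun k => by
    have e : D k (w k) = (D k - F k) (w k) + F k (w k) := by simp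
    rw [e]
    exact (norm_add_le _ _).trans (add_le_add ((hDFw k).trans (hKD ⟨k, rfl⟩)) (hFw k))
  set T : ℕ → E := fun k => w k - C k (w k) - D k (w k) with hT
  have hTb : ∀ k, ‖P (T k)‖ ≤ ‖P‖ * (1 + KC + (KD + KF)) := fun k => by
    refine (P.le_opNorm _).trans (mul_le_mul_of_nonneg_left ?_ (norm_nonneg _))
    refine (norm_sub_le _ _).trans (add_le_add ((norm_sub_le _ _).trans ?_) (hDw k))
    exact add_le_add (hw k).le (hCw k)
  obtain ⟨p, φ, hφ, hp⟩ := exists_tendsto_subseq_of_projection hM0 hM' hsurj hcpt0 hP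
    (p := fun k => P (T k)) (fun k => hPP _) hTb
  have hDF0 : Tendsto (fun k => (D k - F k) (w k)) atTop (𝓝 0) :=
    squeeze_zero_norm hDFw hD
  set r : ℕ → E := fun k => w k - C k (w k) - F k (w k) with hr
  have hrp : Tendsto (r ∘ φ) atTop (𝓝 p) := by
    have h1 := (hlim.add hDF0).comp hφ.tendsto_atTop
    have h2 := h1.add hp
    simp only [add_zero, zero_add] at h2
    refine h2.congr fun k => ?_
    simp only [hr, hT, Function.comp, sub_apply]
    abel
  obtain ⟨S, hS, hmem⟩ := hcpt (max 1 (KC + KF))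
  obtain ⟨f, -, ψ, hψ, hf⟩ := hS.tendsto_subseq
    (fun k => hmem (φ k) (w (φ k)) (w (φ k)) ((hw _).le.trans (le_max_left _ _))
      ((norm_add_le _ _).trans ((add_le_add (hCw _) (hFw _)).trans (le_max_right _ _))))
  set χ : ℕ → ℕ := φ ∘ ψ with hχ
  have hχm : Tendsto χ atTop atTop := hφ.tendsto_atTop.comp hψ.tendsto_atTop
  have hrχ : Tendsto (fun k => r (χ k)) atTop (𝓝 p) := hrp.comp hψ.tendsto_atTop
  have hCχ : ∀ z, Tendsto (fun k => C (χ k) z) atTop (𝓝 (C0 z)) := fun z => (hC z).comp hχm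
  have hFχ : ∀ z, Tendsto (fun k => F (χ k) z) atTop (𝓝 (F0 z)) := fun z => (hF z).comp hχm
  have hFr := tendsto_apply_of_strong hFχ hrχ
  have hFwl : Tendsto (fun k => F (χ k) (w (χ k))) atTop (𝓝 (f + F0 p)) := by
    refine (hf.add hFr).congr fun k => ?_
    simp only [Function.comp, hχ, hr]
    rw [← map_add]
    congr 1
    abel
  obtain ⟨v, hv⟩ := hsurj (p + (f + F0 p))
  have hwv : Tendsto (fun k => w (χ k)) atTop (𝓝 v) := by
    rw [tendsto_iff_norm_sub_tendsto_zero]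
    have h1 : Tendsto (fun k => (r (χ k) + F (χ k) (w (χ k))) - (v - C (χ k) v)) atTop (𝓝 0) := by
      have := (hrχ.add hFwl).sub ((tendsto_const_nhds (x := v)).sub (hCχ v))
      rwa [hv, sub_self] at this
    have h2 := h1.norm.const_mul M
    rw [norm_zero, mul_zero] at h2
    refine squeeze_zero (fun k => norm_nonneg _) (fun k => ?_) h2
    refine (hM (χ k) _).trans (le_of_eq ?_)
    congr 2
    simp only [hr, map_sub]
    abel
  have hr0 : Tendsto (fun k => r (χ k)) atTop (𝓝 (v - C0 v - F0 v)) :=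
    (hwv.sub (tendsto_apply_of_strong hCχ hwv)).sub (tendsto_apply_of_strong hFχ hwv)
  have hpv : p = v - C0 v - F0 v := tendsto_nhds_unique hrχ hr0
  have hPp : P p = p := by
    have h1 : Tendsto (fun k => P (P (T (φ k)))) atTop (𝓝 (P p)) := (P.continuous.tendsto p).comp hp
    simp only [hPP] at h1
    exact tendsto_nhds_unique h1 hp
  have hp0 : p = 0 := by rw [← hPp, hpv, hP]
  obtain ⟨y, hy⟩ := hQ v (hpv ▸ hp0)
  have hQv : Q v = 0 := by
    have h1 : Tendsto (fun k => Q (w (χ k))) atTop (𝓝 (Q v)) := (Q.continuous.tendsto v).comp hwv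
    simp only [hwQ] at h1
    exact tendsto_nhds_unique h1 tendsto_const_nhds
  have hv0 : v = 0 := by rw [← hy, ← hQQ, hy, hQv]
  have := tendsto_nhds_unique hwv.norm (by simp only [hw]; exact tendsto_const_nhds)
  rw [hv0, norm_zero] at this
  exact zero_ne_one this

/-- A time shift changes the integral of a function along a family of transversal characteristics
only by a multiple of the shift. -/
theorem abs_integral_deriv_mul_shift_sub_le {β β' W : ℝ → ℝ} {ω N p q : ℝ} (s s' : ℝ)
    (hβ : ∀ x, HasDerivAt β (β' x) x) (hβ' : Continuous β') (hω : ω ≠ 0) (hW : Continuous W)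
    (hN : ∀ σ, |W σ| ≤ N) :
    |∫ ξ in p..q, β' ξ * (W (s + ω * β ξ) - W (s' + ω * β ξ))| ≤ 2 * N * |s - s'| / |ω| := by
  have hβc : Continuous β := continuous_iff_continuousAt.2 fun x => (hβ x).continuousAt
  have key : ∀ s : ℝ, ∫ ξ in p..q, β' ξ * W (s + ω * β ξ) =
      ω⁻¹ * ∫ σ in (s + ω * β p)..(s + ω * β q), W σ := fun s => by
    have h1 := intervalIntegral.integral_comp_mul_deriv (a := p) (b := q)
      (f := fun ξ => s + ω * β ξ) (f' := fun ξ => ω * β' ξ) (g := W)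
      (fun x _ => ((hβ x).const_mul ω).const_add s) (by fun_prop) hW
    rw [← h1, ← intervalIntegral.integral_const_mul]
    refine intervalIntegral.integral_congr fun ξ _ => ?_
    simp only [Function.comp]
    field_simp
  have hint : ∀ a b, IntervalIntegrable W volume a b := fun a b => hW.intervalIntegrable a b
  have hshort : ∀ B, |∫ σ in (s + B)..(s' + B), W σ| ≤ N * |s - s'| := fun B => by
    have := intervalIntegral.norm_integral_le_of_norm_le_const (a := s + B) (b := s' + B)
      (f := W) (C := N) (fun x _ => hN x)
    rwa [Real.norm_eq_abs, show s' + B - (s + B) = -(s - s') by ring, abs_neg] at this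
  simp only [mul_sub]
  rw [intervalIntegral.integral_sub ((by fun_prop : Continuous _).intervalIntegrable _ _)
    ((by fun_prop : Continuous _).intervalIntegrable _ _), key, key, ← mul_sub,
    intervalIntegral.integral_interval_sub_interval_comm (hint _ _) (hint _ _) (hint _ _),
    abs_mul, abs_inv, div_eq_inv_mul]
  refine mul_le_mul_of_nonneg_left ?_ (by positivity)
  refine (abs_sub _ _).trans ?_
  linarith [hshort (ω * β p), hshort (ω * β q)]

/-- Version of `abs_integral_deriv_mul_shift_sub_le` for an integrand which also depends,
with a modulus of continuity, on the integration variable. -/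
theorem abs_integral_deriv_mul_shift_sub_le_of_modulus {β β' : ℝ → ℝ} {U : ℝ → ℝ → ℝ}
    {ω N K ε p q : ℝ} {n : ℕ} (hn : 0 < n) (s s' : ℝ)
    (hβ : ∀ x, HasDerivAt β (β' x) x) (hβ' : Continuous β') (hω : ω ≠ 0)
    (hU : Continuous fun z : ℝ × ℝ => U z.1 z.2)
    (hN : ∀ ξ ∈ uIcc p q, ∀ σ, |U ξ σ| ≤ N) (hK : ∀ ξ ∈ uIcc p q, |β' ξ| ≤ K)
    (hmod : ∀ ξ ∈ uIcc p q, ∀ ξ' ∈ uIcc p q, |ξ - ξ'| ≤ |q - p| / n →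
      ∀ σ, |U ξ σ - U ξ' σ| ≤ ε) :
    |∫ ξ in p..q, β' ξ * (U ξ (s + ω * β ξ) - U ξ (s' + ω * β ξ))| ≤
      n * (2 * N * |s - s'| / |ω|) + 2 * K * ε * |q - p| := by
  have hβc : Continuous β := continuous_iff_continuousAt.2 fun x => (hβ x).continuousAt
  have hn0 : (0 : ℝ) < n := by exact_mod_cast hn
  set P : ℕ → ℝ := fun i => p + (i / n : ℝ) * (q - p) with hP
  have hPmem : ∀ i ≤ n, P i ∈ uIcc p q := fun i hi => by
    have h0 : (0 : ℝ) ≤ i / n := by positivity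
    have h1 : (i / n : ℝ) ≤ 1 := by
      rw [div_le_one hn0]; exact_mod_cast hi
    rw [mem_uIcc]
    rcases le_total p q with h | h
    · left; constructor <;> simp only [hP] <;> nlinarith
    · right; constructor <;> simp only [hP] <;> nlinarith
  have hstep : ∀ i, P (i + 1) - P i = (q - p) / n := fun i => by
    simp only [hP]; push_cast; field_simp; ring
  have hcont : ∀ (V : ℝ → ℝ → ℝ), (Continuous fun z : ℝ × ℝ => V z.1 z.2) →
      Continuous fun ξ => β' ξ * (V ξ (s + ω * β ξ) - V ξ (s' + ω * β ξ)) := fun V hV => by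
    refine hβ'.mul (Continuous.sub ?_ ?_)
    · exact hV.comp (continuous_id.prodMk (by fun_prop : Continuous fun ξ => s + ω * β ξ))
    · exact hV.comp (continuous_id.prodMk (by fun_prop : Continuous fun ξ => s' + ω * β ξ))
  have hpiece : ∀ i < n, |∫ ξ in (P i)..(P (i + 1)),
      β' ξ * (U ξ (s + ω * β ξ) - U ξ (s' + ω * β ξ))| ≤
      2 * N * |s - s'| / |ω| + 2 * K * ε * (|q - p| / n) := fun i hi => by
    have hUi : Continuous (U (P i)) := hU.comp (by fun_prop : Continuous fun σ => (P i, σ))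
    have e : ∫ ξ in (P i)..(P (i + 1)), β' ξ * (U ξ (s + ω * β ξ) - U ξ (s' + ω * β ξ)) =
        (∫ ξ in (P i)..(P (i + 1)), β' ξ * (U (P i) (s + ω * β ξ) - U (P i) (s' + ω * β ξ))) +
        ∫ ξ in (P i)..(P (i + 1)), β' ξ * ((U ξ (s + ω * β ξ) - U (P i) (s + ω * β ξ)) -
          (U ξ (s' + ω * β ξ) - U (P i) (s' + ω * β ξ))) := by
      rw [← intervalIntegral.integral_add]
      · refine intervalIntegral.integral_congr fun ξ _ => ?_
        ring
      · exact (hcont (fun _ => U (P i)) (hUi.comp continuous_snd)).intervalIntegrable _ _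
      · exact (hcont (fun ξ σ => U ξ σ - U (P i) σ)
          (hU.sub (hUi.comp continuous_snd))).intervalIntegrable _ _
    rw [e]
    refine (abs_add_le _ _).trans (add_le_add
      (abs_integral_deriv_mul_shift_sub_le s s' hβ hβ' hω hUi (hN _ (hPmem i hi.le))) ?_)
    have hsub : uIcc (P i) (P (i + 1)) ⊆ uIcc p q :=
      uIcc_subset_uIcc (hPmem i hi.le) (hPmem (i + 1) hi)
    have := intervalIntegral.norm_integral_le_of_norm_le_const (a := P i) (b := P (i + 1))
      (f := fun ξ => β' ξ * ((U ξ (s + ω * β ξ) - U (P i) (s + ω * β ξ)) -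
          (U ξ (s' + ω * β ξ) - U (P i) (s' + ω * β ξ)))) (C := 2 * K * ε) (fun ξ hξ => by
        have hξ' := uIoc_subset_uIcc hξ
        have hd : |ξ - P i| ≤ |q - p| / n := by
          have := abs_sub_left_of_mem_uIcc hξ'
          rwa [hstep, abs_div, abs_of_pos hn0] at this
        have h1 := hmod ξ (hsub hξ') (P i) (hPmem i hi.le) hd (s + ω * β ξ)
        have h2 := hmod ξ (hsub hξ') (P i) (hPmem i hi.le) hd (s' + ω * β ξ)
        rw [Real.norm_eq_abs, abs_mul]
        have h3 := (abs_sub (U ξ (s + ω * β ξ) - U (P i) (s + ω * β ξ))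
          (U ξ (s' + ω * β ξ) - U (P i) (s' + ω * β ξ))).trans (add_le_add h1 h2)
        calc _ ≤ K * (ε + ε) := mul_le_mul (hK ξ (hsub hξ')) h3 (abs_nonneg _)
              ((abs_nonneg _).trans (hK ξ (hsub hξ')))
          _ = 2 * K * ε := by ring)
    rwa [Real.norm_eq_abs, hstep, abs_div, abs_of_pos hn0] at this
  have hsum := intervalIntegral.sum_integral_adjacent_intervals (n := n) (a := P) (μ := volume)
    (fun i _ => (hcont U hU).intervalIntegrable (P i) (P (i + 1)))
  have hP0 : P 0 = p := by simp [hP]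
  have hPn : P n = q := by simp only [hP]; field_simp; ring
  rw [hP0, hPn] at hsum
  rw [← hsum]
  refine (Finset.abs_sum_le_sum_abs _ _).trans
    ((Finset.sum_le_sum fun i hi => hpiece i (Finset.mem_range.1 hi)).trans (le_of_eq ?_))
  rw [Finset.sum_const, Finset.card_range, nsmul_eq_mul]
  field_simp

/-- Globally continuous coefficients of the integral operators along characteristics:
inverse speeds `A`, exponents `G` of the weights, off-diagonal coupling `D`, base points `X` and
boundary couplings `r`. -/
structure CharCoeffs (n : ℕ) where
  A : Fin n → ℝ → ℝ → ℝ
  G : Fin n → ℝ → ℝ → ℝ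
  D : Fin n → Fin n → ℝ → ℝ → ℝ
  X : Fin n → ℝ
  r : Fin n → Fin n → ℝ
  continuous_A : ∀ j, Continuous fun p : ℝ × ℝ => A j p.1 p.2
  continuous_G : ∀ j, Continuous fun p : ℝ × ℝ => G j p.1 p.2
  continuous_D : ∀ j k, Continuous fun p : ℝ × ℝ => D j k p.1 p.2
  X_mem : ∀ j, X j ∈ Icc (0 : ℝ) 1
  A_ne : ∀ j k, j ≠ k → ∀ x lam, A j x lam ≠ A k x lam
  D_diag : ∀ j x lam, D j j x lam = 0

/-- A jointly continuous function of `(x, λ)` is bounded for `x ∈ [0,1]`, `|λ| ≤ δ`. -/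
theorem exists_abs_le_on_strip {f : ℝ → ℝ → ℝ} (hf : Continuous fun p : ℝ × ℝ => f p.1 p.2)
    (δ : ℝ) : ∃ K, 0 ≤ K ∧ ∀ x ∈ Icc (0 : ℝ) 1, ∀ lam ∈ Icc (-δ) δ, |f x lam| ≤ K := by
  obtain ⟨K, hK⟩ := ((isCompact_Icc (a := (0 : ℝ)) (b := 1)).prod
    (isCompact_Icc (a := -δ) (b := δ))).exists_bound_of_continuousOn hf.continuousOn
  exact ⟨max K 0, le_max_right _ _, fun x hx lam hl => (hK (x, lam) ⟨hx, hl⟩).trans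
    (le_max_left _ _)⟩

/-- Finite families of jointly continuous functions have a common bound on strips. -/
theorem exists_abs_le_on_strip_of_fintype {ι : Type*} [Fintype ι] {f : ι → ℝ → ℝ → ℝ}
    (hf : ∀ i, Continuous fun p : ℝ × ℝ => f i p.1 p.2) (δ : ℝ) :
    ∃ K, 0 ≤ K ∧ ∀ i, ∀ x ∈ Icc (0 : ℝ) 1, ∀ lam ∈ Icc (-δ) δ, |f i x lam| ≤ K := by
  choose K hK0 hK using fun i => exists_abs_le_on_strip (hf i) δ
  exact ⟨∑ i, K i, Finset.sum_nonneg fun i _ => hK0 i, fun i x hx lam hl => (hK i x hx lam hl).trans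
    (Finset.single_le_sum (fun i _ => hK0 i) (Finset.mem_univ i))⟩

/-- A jointly continuous function of `(x, λ)` is equicontinuous in `x ∈ [0,1]` for `|λ| ≤ δ`. -/
theorem exists_modulus_on_strip {f : ℝ → ℝ → ℝ} (hf : Continuous fun p : ℝ × ℝ => f p.1 p.2)
    (δ : ℝ) {ε : ℝ} (hε : 0 < ε) : ∃ η > 0, ∀ x ∈ Icc (0 : ℝ) 1, ∀ x' ∈ Icc (0 : ℝ) 1,
      ∀ lam ∈ Icc (-δ) δ, |x - x'| < η → |f x lam - f x' lam| < ε := by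
  have hu := ((isCompact_Icc (a := (0 : ℝ)) (b := 1)).prod
    (isCompact_Icc (a := -δ) (b := δ))).uniformContinuousOn_of_continuous hf.continuousOn
  obtain ⟨η, hη, h⟩ := Metric.uniformContinuousOn_iff.1 hu ε hε
  refine ⟨η, hη, fun x hx x' hx' lam hl hd => h (x, lam) ⟨hx, hl⟩ (x', lam) ⟨hx', hl⟩ ?_⟩
  rw [Prod.dist_eq]
  simpa [Real.dist_eq, hη] using hd

namespace CharCoeffs

variable {n : ℕ} (c : CharCoeffs n)

/-- The travel time `∫_0^x A_j`. -/
noncomputable def phase (j : Fin n) (x lam : ℝ) : ℝ := ∫ η in (0 : ℝ)..x, c.A j η lam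

/-- The logarithmic weight `∫_0^x G_j`. -/
noncomputable def logw (j : Fin n) (x lam : ℝ) : ℝ := ∫ η in (0 : ℝ)..x, c.G j η lam

/-- The boundary reflection operator along characteristics. -/
noncomputable def refl (lam ω : ℝ) (U : ℝ → ℝ → Fin n → ℝ) (x t : ℝ) (j : Fin n) : ℝ :=
  Real.exp (c.logw j (c.X j) lam - c.logw j x lam) *
    ∑ k, c.r j k * U (c.X j) (t + ω * (c.phase j (c.X j) lam - c.phase j x lam)) k

/-- The integral operator along characteristics. -/
noncomputable def vol (lam ω : ℝ) (U : ℝ → ℝ → Fin n → ℝ) (x t : ℝ) (j : Fin n) : ℝ :=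
  ∫ ξ in (c.X j)..x, Real.exp (c.logw j ξ lam - c.logw j x lam) *
    ∑ k, c.D j k ξ lam * U ξ (t + ω * (c.phase j ξ lam - c.phase j x lam)) k

theorem continuous_integral_of_continuous {f : ℝ → ℝ → ℝ}
    (hf : Continuous fun p : ℝ × ℝ => f p.1 p.2) :
    Continuous fun p : ℝ × ℝ => ∫ η in (0 : ℝ)..p.1, f η p.2 :=
  intervalIntegral.continuous_parametric_intervalIntegral_of_continuous
    (f := fun (p : ℝ × ℝ) η => f η p.2)
    (hf.comp (by fun_prop : Continuous fun q : (ℝ × ℝ) × ℝ => (q.2, q.1.2))) continuous_fst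

theorem continuous_phase (j : Fin n) : Continuous fun p : ℝ × ℝ => c.phase j p.1 p.2 :=
  continuous_integral_of_continuous (c.continuous_A j)

theorem continuous_logw (j : Fin n) : Continuous fun p : ℝ × ℝ => c.logw j p.1 p.2 :=
  continuous_integral_of_continuous (c.continuous_G j)

theorem continuous_phase_left (j : Fin n) (lam : ℝ) : Continuous fun x => c.phase j x lam :=
  (c.continuous_phase j).comp (by fun_prop : Continuous fun x : ℝ => (x, lam))

theorem continuous_logw_left (j : Fin n) (lam : ℝ) : Continuous fun x => c.logw j x lam :=
  (c.continuous_logw j).comp (by fun_prop : Continuous fun x : ℝ => (x, lam))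

theorem continuous_A_left (j : Fin n) (lam : ℝ) : Continuous fun x => c.A j x lam :=
  (c.continuous_A j).comp (by fun_prop : Continuous fun x : ℝ => (x, lam))

theorem continuous_D_left (j k : Fin n) (lam : ℝ) : Continuous fun x => c.D j k x lam :=
  (c.continuous_D j k).comp (by fun_prop : Continuous fun x : ℝ => (x, lam))

theorem hasDerivAt_phase (j : Fin n) (x lam : ℝ) :
    HasDerivAt (fun x => c.phase j x lam) (c.A j x lam) x :=
  intervalIntegral.integral_hasDerivAt_right
    ((c.continuous_A_left j lam).intervalIntegrable _ _)
    ((c.continuous_A_left j lam).stronglyMeasurableAtFilter _ _)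
    (c.continuous_A_left j lam).continuousAt

theorem continuous_refl {U : ℝ → ℝ → Fin n → ℝ} (hU : Continuous fun p : ℝ × ℝ => U p.1 p.2)
    (j : Fin n) :
    Continuous fun z : (ℝ × ℝ) × ℝ × ℝ => c.refl z.1.1 z.1.2 U z.2.1 z.2.2 j := by
  have h1 : Continuous fun z : (ℝ × ℝ) × ℝ × ℝ => c.logw j (c.X j) z.1.1 :=
    (c.continuous_logw j).comp
      (by fun_prop : Continuous fun z : (ℝ × ℝ) × ℝ × ℝ => (c.X j, z.1.1))
  have h2 : Continuous fun z : (ℝ × ℝ) × ℝ × ℝ => c.logw j z.2.1 z.1.1 :=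
    (c.continuous_logw j).comp
      (by fun_prop : Continuous fun z : (ℝ × ℝ) × ℝ × ℝ => (z.2.1, z.1.1))
  have h3 : Continuous fun z : (ℝ × ℝ) × ℝ × ℝ => c.phase j (c.X j) z.1.1 :=
    (c.continuous_phase j).comp
      (by fun_prop : Continuous fun z : (ℝ × ℝ) × ℝ × ℝ => (c.X j, z.1.1))
  have h4 : Continuous fun z : (ℝ × ℝ) × ℝ × ℝ => c.phase j z.2.1 z.1.1 :=
    (c.continuous_phase j).comp
      (by fun_prop : Continuous fun z : (ℝ × ℝ) × ℝ × ℝ => (z.2.1, z.1.1))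
  refine (Real.continuous_exp.comp (h1.sub h2)).mul
    (continuous_finsetSum _ fun k _ => continuous_const.mul ?_)
  refine (continuous_apply k).comp (hU.comp (f := fun z : (ℝ × ℝ) × ℝ × ℝ => (c.X j,
    z.2.2 + z.1.2 * (c.phase j (c.X j) z.1.1 - c.phase j z.2.1 z.1.1))) ?_)
  fun_prop

theorem continuous_vol {U : ℝ → ℝ → Fin n → ℝ} (hU : Continuous fun p : ℝ × ℝ => U p.1 p.2)
    (j : Fin n) :
    Continuous fun z : (ℝ × ℝ) × ℝ × ℝ => c.vol z.1.1 z.1.2 U z.2.1 z.2.2 j := by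
  refine intervalIntegral.continuous_parametric_intervalIntegral_of_continuous
    (f := fun (z : (ℝ × ℝ) × ℝ × ℝ) ξ => Real.exp (c.logw j ξ z.1.1 - c.logw j z.2.1 z.1.1) *
      ∑ k, c.D j k ξ z.1.1 *
        U ξ (z.2.2 + z.1.2 * (c.phase j ξ z.1.1 - c.phase j z.2.1 z.1.1)) k) ?_
    (continuous_fst.comp continuous_snd)
  have e1 : Continuous fun q : ((ℝ × ℝ) × ℝ × ℝ) × ℝ => (q.2, q.1.1.1) := by fun_prop
  have e2 : Continuous fun q : ((ℝ × ℝ) × ℝ × ℝ) × ℝ => (q.1.2.1, q.1.1.1) := by fun_prop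
  have h1 := (c.continuous_logw j).comp e1
  have h2 := (c.continuous_logw j).comp e2
  have h3 := (c.continuous_phase j).comp e1
  have h4 := (c.continuous_phase j).comp e2
  simp only [Function.comp_def] at h1 h2 h3 h4
  refine (Real.continuous_exp.comp (h1.sub h2)).mul
    (continuous_finsetSum _ fun k _ => ((c.continuous_D j k).comp e1).mul ?_)
  refine (continuous_apply k).comp (hU.comp (f := fun q : ((ℝ × ℝ) × ℝ × ℝ) × ℝ => (q.2,
    q.1.2.2 + q.1.1.2 * (c.phase j q.2 q.1.1.1 - c.phase j q.1.2.1 q.1.1.1))) ?_)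
  fun_prop

end CharCoeffs

namespace CharCoeffs

variable {n : ℕ} (c : CharCoeffs n)

/-- The `(j,k)` contribution to `vol`, in characteristic coordinates. -/
noncomputable def volPart (lam ω : ℝ) (U : ℝ → ℝ → Fin n → ℝ) (j k : Fin n) (x s : ℝ) : ℝ :=
  ∫ ξ in (c.X j)..x,
    Real.exp (c.logw j ξ lam) * (c.D j k ξ lam * U ξ (s + ω * c.phase j ξ lam) k)

theorem continuous_volPart_integrand {U : ℝ → ℝ → Fin n → ℝ}
    (hU : Continuous fun p : ℝ × ℝ => U p.1 p.2) (lam ω : ℝ) (j k l : Fin n) (s : ℝ) :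
    Continuous fun ξ => Real.exp (c.logw j ξ lam) *
      (c.D j k ξ lam * U ξ (s + ω * c.phase j ξ lam) l) := by
  have h1 := c.continuous_logw_left j lam
  have h2 := c.continuous_phase_left j lam
  have h3 := c.continuous_D_left j k lam
  have h4 : Continuous fun ξ => U ξ (s + ω * c.phase j ξ lam) l :=
    (continuous_apply l).comp (hU.comp (f := fun ξ => (ξ, s + ω * c.phase j ξ lam)) (by fun_prop))
  fun_prop

theorem vol_eq_sum_volPart {U : ℝ → ℝ → Fin n → ℝ}
    (hU : Continuous fun p : ℝ × ℝ => U p.1 p.2) (lam ω x t : ℝ) (j : Fin n) :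
    c.vol lam ω U x t j = Real.exp (-c.logw j x lam) *
      ∑ k, c.volPart lam ω U j k x (t - ω * c.phase j x lam) := by
  simp only [vol, volPart]
  rw [← intervalIntegral.integral_finsetSum fun k _ =>
    (c.continuous_volPart_integrand hU lam ω j k k _).intervalIntegrable _ _,
    ← intervalIntegral.integral_const_mul]
  refine intervalIntegral.integral_congr fun ξ _ => ?_
  rw [sub_eq_add_neg, Real.exp_add, mul_comm (Real.exp (c.logw j ξ lam)), mul_assoc,
    Finset.mul_sum]
  congr 1
  refine Finset.sum_congr rfl fun k _ => ?_
  rw [show t + ω * (c.phase j ξ lam - c.phase j x lam) =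
    t - ω * c.phase j x lam + ω * c.phase j ξ lam by ring]

/-- `K` bounds the coefficients and the weights for `x ∈ [0,1]` and `λ ∈ [-δ,δ]`. -/
def IsBound (δ K : ℝ) : Prop :=
  ∀ x ∈ Icc (0 : ℝ) 1, ∀ lam ∈ Icc (-δ) δ, ∀ j k,
    |c.A j x lam| ≤ K ∧ Real.exp (c.logw j x lam) ≤ K ∧ Real.exp (-c.logw j x lam) ≤ K ∧
      |c.D j k x lam| ≤ K

theorem exists_bounds (δ : ℝ) : ∃ K, 0 ≤ K ∧ c.IsBound δ K := by
  obtain ⟨K1, h10, h1⟩ := exists_abs_le_on_strip_of_fintype c.continuous_A δ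
  obtain ⟨K2, h20, h2⟩ := exists_abs_le_on_strip_of_fintype
    (f := fun j x lam => Real.exp (c.logw j x lam))
    (fun j => Real.continuous_exp.comp (c.continuous_logw j)) δ
  obtain ⟨K3, h30, h3⟩ := exists_abs_le_on_strip_of_fintype
    (f := fun j x lam => Real.exp (-c.logw j x lam))
    (fun j => Real.continuous_exp.comp (c.continuous_logw j).neg) δ
  obtain ⟨K4, h40, h4⟩ := exists_abs_le_on_strip_of_fintype
    (f := fun (i : Fin n × Fin n) => c.D i.1 i.2) (fun i => c.continuous_D i.1 i.2) δ
  refine ⟨K1 + K2 + K3 + K4, by positivity, fun x hx lam hl j k => ⟨?_, ?_, ?_, ?_⟩⟩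
  · linarith [h1 j x hx lam hl]
  · linarith [h2 j x hx lam hl, le_abs_self (Real.exp (c.logw j x lam))]
  · linarith [h3 j x hx lam hl, le_abs_self (Real.exp (-c.logw j x lam))]
  · linarith [h4 (j, k) x hx lam hl]

theorem abs_integral_le_of_unit {f : ℝ → ℝ} {p q C : ℝ} (hp : p ∈ Icc (0 : ℝ) 1)
    (hq : q ∈ Icc (0 : ℝ) 1) (hf : ∀ ξ ∈ Icc (0 : ℝ) 1, |f ξ| ≤ C) :
    |∫ ξ in p..q, f ξ| ≤ C * |q - p| := by
  rw [← Real.norm_eq_abs]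
  exact intervalIntegral.norm_integral_le_of_norm_le_const fun ξ hξ =>
    hf ξ (uIcc_subset_Icc hp hq (uIoc_subset_uIcc hξ))

section

variable {δ K R : ℝ}

theorem abs_volPart_integrand_le (hK0 : 0 ≤ K) (hK : c.IsBound δ K)
    {lam : ℝ} (hl : lam ∈ Icc (-δ) δ) {U : ℝ → ℝ → Fin n → ℝ}
    (hUR : ∀ x t j, |U x t j| ≤ R) {ξ : ℝ} (hξ : ξ ∈ Icc (0 : ℝ) 1) (j k l : Fin n) (σ : ℝ) :
    |Real.exp (c.logw j ξ lam) * (c.D j k ξ lam * U ξ σ l)| ≤ K * (K * R) := by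
  obtain ⟨-, h2, -, h4⟩ := hK ξ hξ lam hl j k
  rw [abs_mul, abs_mul, Real.abs_exp]
  gcongr
  exact hUR _ _ _

/-- A function of the form `C y + F z`, multiplied by its weight and followed along its own
characteristic, is Lipschitz. -/
theorem abs_weighted_sub_le (hK0 : 0 ≤ K) (hK : c.IsBound δ K)
    {lam ω : ℝ} (hl : lam ∈ Icc (-δ) δ) {Y V Z : ℝ → ℝ → Fin n → ℝ}
    (hZ : Continuous fun p : ℝ × ℝ => Z p.1 p.2) (hZR : ∀ x t j, |Z x t j| ≤ R)
    (hY : ∀ x ∈ Icc (0 : ℝ) 1, ∀ t j, Y x t j = c.refl lam ω V x t j + c.vol lam ω Z x t j)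
    {x x' : ℝ} (hx : x ∈ Icc (0 : ℝ) 1) (hx' : x' ∈ Icc (0 : ℝ) 1) (k : Fin n) (σ : ℝ) :
    |Real.exp (c.logw k x lam) * Y x (σ + ω * c.phase k x lam) k -
      Real.exp (c.logw k x' lam) * Y x' (σ + ω * c.phase k x' lam) k| ≤
      n * (K * (K * R)) * |x - x'| := by
  have key : ∀ x ∈ Icc (0 : ℝ) 1,
      Real.exp (c.logw k x lam) * Y x (σ + ω * c.phase k x lam) k =
      Real.exp (c.logw k (c.X k) lam) *
        (∑ l, c.r k l * V (c.X k) (σ + ω * c.phase k (c.X k) lam) l) +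
      ∑ l, c.volPart lam ω Z k l x σ := fun x hx => by
    rw [hY x hx, c.vol_eq_sum_volPart hZ, mul_add, ← mul_assoc, ← Real.exp_add, add_neg_cancel,
      Real.exp_zero, one_mul, refl, ← mul_assoc, ← Real.exp_add]
    rw [add_sub_cancel_right, add_sub_cancel, show σ + ω * c.phase k x lam +
      ω * (c.phase k (c.X k) lam - c.phase k x lam) = σ + ω * c.phase k (c.X k) lam by ring]
  rw [key x hx, key x' hx', add_sub_add_left_eq_sub, ← Finset.sum_sub_distrib]
  refine (Finset.abs_sum_le_sum_abs _ _).trans ((Finset.sum_le_sum (g := fun _ : Fin n =>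
    K * (K * R) * |x - x'|) fun l _ => ?_).trans (le_of_eq ?_))
  · have hc := c.continuous_volPart_integrand hZ lam ω k l l σ
    rw [volPart, volPart, intervalIntegral.integral_interval_sub_left
      (hc.intervalIntegrable _ _) (hc.intervalIntegrable _ _)]
    exact abs_integral_le_of_unit hx' hx fun ξ hξ =>
      c.abs_volPart_integrand_le hK0 hK hl hZR hξ k l l _
  · simp [mul_assoc]

theorem abs_volPart_sub_le (hK0 : 0 ≤ K) (hK : c.IsBound δ K)
    {lam ω : ℝ} (hl : lam ∈ Icc (-δ) δ) {U : ℝ → ℝ → Fin n → ℝ}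
    (hU : Continuous fun p : ℝ × ℝ => U p.1 p.2) (hUR : ∀ x t j, |U x t j| ≤ R)
    {x x' : ℝ} (hx : x ∈ Icc (0 : ℝ) 1) (hx' : x' ∈ Icc (0 : ℝ) 1) (j k : Fin n) (s : ℝ) :
    |c.volPart lam ω U j k x s - c.volPart lam ω U j k x' s| ≤ K * (K * R) * |x - x'| := by
  have hc := c.continuous_volPart_integrand hU lam ω j k k s
  rw [volPart, volPart, intervalIntegral.integral_interval_sub_left
    (hc.intervalIntegrable _ _) (hc.intervalIntegrable _ _)]
  exact abs_integral_le_of_unit hx' hx fun ξ hξ =>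
    c.abs_volPart_integrand_le hK0 hK hl hUR hξ j k k _

theorem abs_volPart_le (hK0 : 0 ≤ K) (hK : c.IsBound δ K)
    {lam ω : ℝ} (hl : lam ∈ Icc (-δ) δ) {U : ℝ → ℝ → Fin n → ℝ}
    (hR : 0 ≤ R) (hUR : ∀ x t j, |U x t j| ≤ R)
    {x : ℝ} (hx : x ∈ Icc (0 : ℝ) 1) (j k : Fin n) (s : ℝ) :
    |c.volPart lam ω U j k x s| ≤ K * (K * R) := by
  refine (abs_integral_le_of_unit (C := K * (K * R)) (c.X_mem j) hx fun ξ hξ =>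
    c.abs_volPart_integrand_le hK0 hK hl hUR hξ j k k _).trans
    (mul_le_of_le_one_right (by positivity) ?_)
  have := c.X_mem j
  rw [abs_le]
  constructor <;> linarith [hx.1, hx.2, this.1, this.2]

theorem abs_phase_sub_le (hK : c.IsBound δ K)
    {lam : ℝ} (hl : lam ∈ Icc (-δ) δ) {x x' : ℝ} (hx : x ∈ Icc (0 : ℝ) 1)
    (hx' : x' ∈ Icc (0 : ℝ) 1) (j : Fin n) : |c.phase j x lam - c.phase j x' lam| ≤ K * |x - x'| := by
  have hc := c.continuous_A_left j lam
  rw [phase, phase, intervalIntegral.integral_interval_sub_left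
    (hc.intervalIntegrable _ _) (hc.intervalIntegrable _ _)]
  exact abs_integral_le_of_unit hx' hx fun ξ hξ => (hK ξ hξ lam hl j j).1

/-- Uniform equicontinuity in time of the contributions to `F (C y + F z)`. -/
theorem exists_modulus_volPart (hK0 : 0 ≤ K) (hK : c.IsBound δ K)
    (hR : 0 ≤ R) (j k : Fin n) {ε : ℝ} (hε : 0 < ε) :
    ∃ η > 0, ∀ lam ∈ Icc (-δ) δ, ∀ ω : ℝ, 1 / 2 ≤ ω → ∀ Y V Z : ℝ → ℝ → Fin n → ℝ,
      (Continuous fun p : ℝ × ℝ => Y p.1 p.2) → (∀ x t j, |Y x t j| ≤ R) →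
      (Continuous fun p : ℝ × ℝ => Z p.1 p.2) → (∀ x t j, |Z x t j| ≤ R) →
      (∀ x ∈ Icc (0 : ℝ) 1, ∀ t j, Y x t j = c.refl lam ω V x t j + c.vol lam ω Z x t j) →
      ∀ x ∈ Icc (0 : ℝ) 1, ∀ s s', |s - s'| < η →
        |c.volPart lam ω Y j k x s - c.volPart lam ω Y j k x s'| ≤ ε := by
  rcases eq_or_ne j k with rfl | hjk
  · refine ⟨1, one_pos, fun lam _ ω _ Y V Z _ _ _ _ _ x _ s s' _ => ?_⟩
    simp [volPart, c.D_diag, hε.le]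
  set ρ : ℝ → ℝ → ℝ := fun x lam => Real.exp (c.logw j x lam - c.logw k x lam) *
    c.D j k x lam / (c.A j x lam - c.A k x lam) with hρ
  have hρc : Continuous fun p : ℝ × ℝ => ρ p.1 p.2 :=
    ((Real.continuous_exp.comp ((c.continuous_logw j).sub (c.continuous_logw k))).mul
      (c.continuous_D j k)).div ((c.continuous_A j).sub (c.continuous_A k))
      fun p => sub_ne_zero.2 (c.A_ne j k hjk _ _)
  obtain ⟨Kρ, hKρ0, hKρ⟩ := exists_abs_le_on_strip hρc δ
  set NV : ℝ := K * R
  have hNV0 : 0 ≤ NV := by positivity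
  set L : ℝ := n * (K * (K * R))
  have hL0 : 0 ≤ L := by positivity
  set ε1 : ℝ := ε / (8 * (K + 1) * (1 + NV)) with hε1
  have hε1pos : 0 < ε1 := by positivity
  obtain ⟨h, hh, hmod⟩ := exists_modulus_on_strip hρc δ hε1pos
  obtain ⟨N, hN⟩ := exists_nat_gt (1 / h + Kρ * L / ε1)
  have hN0 : (0 : ℝ) < N := lt_of_le_of_lt (by positivity) hN
  have hNh : 1 / (N : ℝ) < h := by
    rw [div_lt_comm₀ hN0 hh]
    exact lt_of_le_of_lt (le_add_of_nonneg_right (by positivity)) hN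
  have hNL : Kρ * L * (1 / (N : ℝ)) ≤ ε1 := by
    rw [mul_one_div, div_le_comm₀ hN0 hε1pos]
    exact (lt_of_le_of_lt (le_add_of_nonneg_left (by positivity)) hN).le
  set η : ℝ := ε / (2 * (N * (4 * (Kρ * NV)) + 1)) with hη
  have hηpos : 0 < η := by positivity
  refine ⟨η, hηpos, fun lam hl ω hω Y V Z hYc hYR hZc hZR hY x hx s s' hs => ?_⟩
  have hω0 : 0 < ω := by linarith
  set Vk : ℝ → ℝ → ℝ := fun ξ σ => Real.exp (c.logw k ξ lam) * Y ξ (σ + ω * c.phase k ξ lam) k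
    with hVk
  have hVkc : Continuous fun z : ℝ × ℝ => Vk z.1 z.2 := by
    have h1 := (c.continuous_logw_left k lam).comp (continuous_fst (X := ℝ) (Y := ℝ))
    have h2 := (c.continuous_phase_left k lam).comp (continuous_fst (X := ℝ) (Y := ℝ))
    simp only [Function.comp_def] at h1 h2
    refine (Real.continuous_exp.comp h1).mul ((continuous_apply k).comp (hYc.comp
      (f := fun z : ℝ × ℝ => (z.1, z.2 + ω * c.phase k z.1 lam)) (by fun_prop)))
  have hVkN : ∀ ξ ∈ Icc (0 : ℝ) 1, ∀ σ, |Vk ξ σ| ≤ NV := fun ξ hξ σ => by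
    rw [hVk, abs_mul, Real.abs_exp]
    exact mul_le_mul (hK ξ hξ lam hl k k).2.1 (hYR _ _ _) (abs_nonneg _) hK0
  set β : ℝ → ℝ := fun ξ => c.phase j ξ lam - c.phase k ξ lam with hβ
  set β' : ℝ → ℝ := fun ξ => c.A j ξ lam - c.A k ξ lam with hβ'
  have hd : ∀ ξ, HasDerivAt β (β' ξ) ξ := fun ξ =>
    (c.hasDerivAt_phase j ξ lam).sub (c.hasDerivAt_phase k ξ lam)
  have hβ'c : Continuous β' := (c.continuous_A_left j lam).sub (c.continuous_A_left k lam)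
  have e : ∀ s, c.volPart lam ω Y j k x s =
      ∫ ξ in (c.X j)..x, β' ξ * (ρ ξ lam * Vk ξ (s + ω * β ξ)) := fun s => by
    refine intervalIntegral.integral_congr fun ξ _ => ?_
    have hne : c.A j ξ lam - c.A k ξ lam ≠ 0 := sub_ne_zero.2 (c.A_ne j k hjk _ _)
    have harg : s + ω * β ξ + ω * c.phase k ξ lam = s + ω * c.phase j ξ lam := by
      simp only [hβ]; ring
    simp only [hρ, hVk, hβ', harg]
    rw [sub_eq_add_neg (c.logw j ξ lam), Real.exp_add, Real.exp_neg]
    field_simp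
  have hρlc : Continuous fun ξ => ρ ξ lam :=
    hρc.comp (by fun_prop : Continuous fun ξ : ℝ => (ξ, lam))
  have hUc : Continuous fun z : ℝ × ℝ => ρ z.1 lam * Vk z.1 z.2 :=
    (hρlc.comp continuous_fst).mul hVkc
  have hβc : Continuous β := continuous_iff_continuousAt.2 fun x => (hd x).continuousAt
  have hic : ∀ s, Continuous fun ξ => β' ξ * (ρ ξ lam * Vk ξ (s + ω * β ξ)) := fun s =>
    hβ'c.mul (hUc.comp (f := fun ξ => (ξ, s + ω * β ξ)) (by fun_prop))
  rw [e s, e s', ← intervalIntegral.integral_sub ((hic s).intervalIntegrable _ _)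
    ((hic s').intervalIntegrable _ _)]
  simp only [← mul_sub (β' _)]
  have hsub := uIcc_subset_Icc (c.X_mem j) hx
  have hlen : |x - c.X j| ≤ 1 := by
    have := c.X_mem j
    rw [abs_le]
    constructor <;> linarith [hx.1, hx.2, this.1, this.2]
  have hmain := abs_integral_deriv_mul_shift_sub_le_of_modulus (p := c.X j) (q := x)
    (U := fun ξ σ => ρ ξ lam * Vk ξ σ) (N := Kρ * NV) (K := 2 * K) (ε := ε1 * (1 + NV)) (n := N)
    (by exact_mod_cast hN0) s s' hd hβ'c hω0.ne' hUc
    (fun ξ hξ σ => by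
      rw [abs_mul]
      exact mul_le_mul (hKρ ξ (hsub hξ) lam hl) (hVkN ξ (hsub hξ) σ) (abs_nonneg _) hKρ0)
    (fun ξ hξ => (abs_sub _ _).trans (by
      linarith [(hK ξ (hsub hξ) lam hl j j).1, (hK ξ (hsub hξ) lam hl k k).1]))
    (fun ξ hξ ξ' hξ' hdist σ => by
      have hdist' : |ξ - ξ'| ≤ 1 / N := hdist.trans (by gcongr)
      have h1 := hmod ξ (hsub hξ) ξ' (hsub hξ') lam hl (hdist'.trans_lt hNh)
      have h2 := c.abs_weighted_sub_le hK0 hK hl hZc hZR hY (hsub hξ) (hsub hξ') k σ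
      have h3 : ρ ξ lam * Vk ξ σ - ρ ξ' lam * Vk ξ' σ =
          ρ ξ lam * (Vk ξ σ - Vk ξ' σ) + (ρ ξ lam - ρ ξ' lam) * Vk ξ' σ := by ring
      rw [h3]
      refine (abs_add_le _ _).trans ?_
      rw [abs_mul, abs_mul]
      have h4 : |ρ ξ lam| * |Vk ξ σ - Vk ξ' σ| ≤ Kρ * (L * (1 / N)) :=
        mul_le_mul (hKρ ξ (hsub hξ) lam hl)
          (h2.trans (mul_le_mul_of_nonneg_left hdist' hL0)) (abs_nonneg _) hKρ0
      have h5 : |ρ ξ lam - ρ ξ' lam| * |Vk ξ' σ| ≤ ε1 * NV :=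
        mul_le_mul h1.le (hVkN ξ' (hsub hξ') σ) (abs_nonneg _) hε1pos.le
      linarith [mul_assoc Kρ L (1 / (N : ℝ))])
  refine hmain.trans ?_
  have t1 : (N : ℝ) * (2 * (Kρ * NV) * |s - s'| / |ω|) ≤ ε / 2 := by
    have a1 : 2 * (Kρ * NV) * |s - s'| / |ω| ≤ 4 * (Kρ * NV) * η := by
      rw [abs_of_pos hω0, div_le_iff₀ hω0]
      have : 2 * (Kρ * NV) * |s - s'| ≤ 2 * (Kρ * NV) * η := by gcongr
      nlinarith [mul_nonneg (mul_nonneg hKρ0 hNV0) hηpos.le]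
    have a2 : (N * (4 * (Kρ * NV)) + 1) * η = ε / 2 := by
      rw [hη]; field_simp
    have a3 : (N : ℝ) * (2 * (Kρ * NV) * |s - s'| / |ω|) ≤ N * (4 * (Kρ * NV) * η) := by gcongr
    nlinarith
  have t2 : 2 * (2 * K) * (ε1 * (1 + NV)) * |x - c.X j| ≤ ε / 2 := by
    have a1 : 2 * (2 * K) * (ε1 * (1 + NV)) * |x - c.X j| ≤ 2 * (2 * K) * (ε1 * (1 + NV)) :=
      mul_le_of_le_one_right (by positivity) hlen
    have a2 : 2 * (2 * (K + 1)) * (ε1 * (1 + NV)) = ε / 2 := by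
      rw [hε1]; field_simp; norm_num
    nlinarith [mul_nonneg hε1pos.le (by positivity : 0 ≤ 1 + NV)]
  linarith

/-- Uniform equicontinuity of the functions `F (C y + F z)`. -/
theorem exists_modulus_vol (hK0 : 0 ≤ K) (hK : c.IsBound δ K)
    (hR : 0 ≤ R) (j : Fin n) {ε : ℝ} (hε : 0 < ε) :
    ∃ η > 0, ∀ lam ∈ Icc (-δ) δ, ∀ ω ∈ Icc (1 / 2 : ℝ) (3 / 2), ∀ Y V Z : ℝ → ℝ → Fin n → ℝ,
      (Continuous fun p : ℝ × ℝ => Y p.1 p.2) → (∀ x t j, |Y x t j| ≤ R) →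
      (Continuous fun p : ℝ × ℝ => Z p.1 p.2) → (∀ x t j, |Z x t j| ≤ R) →
      (∀ x ∈ Icc (0 : ℝ) 1, ∀ t j, Y x t j = c.refl lam ω V x t j + c.vol lam ω Z x t j) →
      ∀ x ∈ Icc (0 : ℝ) 1, ∀ x' ∈ Icc (0 : ℝ) 1, ∀ t t', |x - x'| < η → |t - t'| < η →
        |c.vol lam ω Y x t j - c.vol lam ω Y x' t' j| ≤ ε := by
  set B : ℝ := K * (K * R)
  have hB0 : 0 ≤ B := by positivity
  set ε1 : ℝ := ε / (3 * (K + 1) * (n + 1)) with hε1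
  have hε1pos : 0 < ε1 := by positivity
  set ε2 : ℝ := ε / (3 * (n * B + 1)) with hε2
  have hε2pos : 0 < ε2 := by positivity
  choose η1 hη1 H1 using fun k => c.exists_modulus_volPart hK0 hK hR j k hε1pos
  obtain ⟨η2, hη2, H2⟩ := exists_modulus_on_strip
    (f := fun x lam => Real.exp (-c.logw j x lam))
    (Real.continuous_exp.comp (c.continuous_logw j).neg) δ hε2pos
  obtain ⟨η3, hη3, H3⟩ : ∃ η3 > 0, ∀ k, η3 ≤ η1 k := by
    rcases isEmpty_or_nonempty (Fin n) with he | he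
    · exact ⟨1, one_pos, fun k => (he.false k).elim⟩
    · obtain ⟨k, hk⟩ := Finite.exists_min η1
      exact ⟨η1 k, hη1 k, hk⟩
  set η4 : ℝ := η3 / (1 + 2 * K) with hη4
  have hη4pos : 0 < η4 := by positivity
  set η5 : ℝ := ε1 / (B + 1) with hη5
  have hη5pos : 0 < η5 := by positivity
  refine ⟨min η2 (min η4 η5), by positivity,
    fun lam hl ω hω Y V Z hYc hYR hZc hZR hY x hx x' hx' t t' hxx htt => ?_⟩
  rw [lt_min_iff, lt_min_iff] at hxx htt
  set s : ℝ := t - ω * c.phase j x lam with hs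
  set s' : ℝ := t' - ω * c.phase j x' lam with hs'
  have hss : |s - s'| < η3 := by
    have h1 := c.abs_phase_sub_le hK hl hx hx' j
    have h2 : s - s' = (t - t') - ω * (c.phase j x lam - c.phase j x' lam) := by
      simp only [hs, hs']; ring
    rw [h2]
    refine (abs_sub _ _).trans_lt ?_
    rw [abs_mul, abs_of_nonneg (by linarith [hω.1] : 0 ≤ ω)]
    have h3 : ω * |c.phase j x lam - c.phase j x' lam| ≤ 2 * (K * |x - x'|) :=
      mul_le_mul (by linarith [hω.2]) h1 (abs_nonneg _) (by norm_num)
    have h4 : (1 + 2 * K) * η4 = η3 := by rw [hη4]; field_simp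
    have h5 : 2 * (K * |x - x'|) ≤ 2 * K * η4 := by nlinarith [hxx.2.1]
    linarith [htt.2.1]
  have hpart : ∀ k, |c.volPart lam ω Y j k x s - c.volPart lam ω Y j k x' s'| ≤ 2 * ε1 :=
    fun k => by
    have h1 := H1 k lam hl ω hω.1 Y V Z hYc hYR hZc hZR hY x hx s s' (hss.trans_le (H3 k))
    have h2 := c.abs_volPart_sub_le hK0 hK (ω := ω) hl hYc hYR hx hx' j k s'
    have h3 : B * |x - x'| ≤ ε1 := by
      have : (B + 1) * η5 = ε1 := by rw [hη5]; field_simp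
      nlinarith [hxx.2.2, abs_nonneg (x - x')]
    have := abs_sub_le (c.volPart lam ω Y j k x s) (c.volPart lam ω Y j k x s')
      (c.volPart lam ω Y j k x' s')
    linarith
  rw [c.vol_eq_sum_volPart hYc, c.vol_eq_sum_volPart hYc, ← hs, ← hs']
  set a := ∑ k, c.volPart lam ω Y j k x s
  set a' := ∑ k, c.volPart lam ω Y j k x' s'
  have haa : |a - a'| ≤ n * (2 * ε1) := by
    rw [← Finset.sum_sub_distrib]
    refine (Finset.abs_sum_le_sum_abs _ _).trans ((Finset.sum_le_sum fun k _ => hpart k).trans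
      (le_of_eq ?_))
    simp
  have ha' : |a'| ≤ n * B := by
    refine (Finset.abs_sum_le_sum_abs _ _).trans ((Finset.sum_le_sum fun k _ =>
      c.abs_volPart_le hK0 hK hl hR hYR hx' j k s').trans (le_of_eq ?_))
    simp [B]
  have hee := H2 x hx x' hx' lam hl hxx.1
  set e := Real.exp (-c.logw j x lam)
  set e' := Real.exp (-c.logw j x' lam)
  have he : |e| ≤ K := by
    rw [Real.abs_exp]; exact (hK x hx lam hl j j).2.2.1
  have hsplit : e * a - e' * a' = e * (a - a') + (e - e') * a' := by ring
  rw [hsplit]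
  refine (abs_add_le _ _).trans ?_
  rw [abs_mul, abs_mul]
  have u1 : |e| * |a - a'| ≤ K * (n * (2 * ε1)) := mul_le_mul he haa (abs_nonneg _) hK0
  have u2 : |e - e'| * |a'| ≤ ε2 * (n * B) := mul_le_mul hee.le ha' (abs_nonneg _) hε2pos.le
  have u3 : (K + 1) * (n + 1) * ε1 = ε / 3 := by rw [hε1]; field_simp
  have u4 : (n * B + 1) * ε2 = ε / 3 := by rw [hε2]; field_simp
  have u5 : K * (n * (2 * ε1)) ≤ 2 * (ε / 3) := by
    have : 0 ≤ ε1 * (K + n + 1) := by positivity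
    nlinarith
  linarith

end

end CharCoeffs

section Evaluation

variable {n : ℕ}

theorem ev_add (u v : Cspace n) (x t : ℝ) : ev (u + v) x t = ev u x t + ev v x t := rfl

theorem ev_sub (u v : Cspace n) (x t : ℝ) : ev (u - v) x t = ev u x t - ev v x t := rfl

theorem continuous_ev (u : Cspace n) : Continuous fun p : ℝ × ℝ => ev u p.1 p.2 :=
  u.continuous.comp ((continuous_projIcc.comp continuous_fst).prodMk
    ((AddCircle.continuous_mk' _).comp continuous_snd))

theorem norm_ev_le (u : Cspace n) (x t : ℝ) : ‖ev u x t‖ ≤ ‖u‖ := u.norm_coe_le_norm _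

theorem abs_ev_le (u : Cspace n) (x t : ℝ) (j : Fin n) : |ev u x t j| ≤ ‖u‖ :=
  (norm_le_pi_norm (ev u x t) j).trans (norm_ev_le u x t)

theorem exists_ev_eq (z : Dom) : ∃ x ∈ Icc (0 : ℝ) 1, ∃ t ∈ Icc (0 : ℝ) (2 * π),
    ∀ u : Cspace n, ev u x t = u z := by
  obtain ⟨⟨x, hx⟩, θ⟩ := z
  have : θ ∈ ((↑) : ℝ → TimeCircle) '' Icc 0 (0 + 2 * π) := by
    rw [AddCircle.coe_image_Icc_eq]; trivial
  obtain ⟨t, ht, rfl⟩ := this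
  rw [zero_add] at ht
  refine ⟨x, hx, t, ht, fun u => ?_⟩
  rw [ev, projIcc_of_mem zero_le_one hx]

theorem norm_le_of_abs_ev_le {u : Cspace n} {M : ℝ} (hM : 0 ≤ M)
    (h : ∀ x ∈ Icc (0 : ℝ) 1, ∀ t ∈ Icc (0 : ℝ) (2 * π), ∀ j, |ev u x t j| ≤ M) : ‖u‖ ≤ M := by
  rw [ContinuousMap.norm_le _ hM]
  intro z
  obtain ⟨x, hx, t, ht, hz⟩ := exists_ev_eq (n := n) z
  rw [← hz u, pi_norm_le_iff_of_nonneg hM]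
  exact h x hx t ht

theorem tendsto_of_ev_eq {G : (ℝ × ℝ) → ℝ → ℝ → Fin n → ℝ}
    (hG : ∀ j, Continuous fun z : (ℝ × ℝ) × ℝ × ℝ => G z.1 z.2.1 z.2.2 j)
    {p : ℕ → ℝ × ℝ} {p0 : ℝ × ℝ} (hp : Tendsto p atTop (𝓝 p0)) {u : ℕ → Cspace n} {v : Cspace n}
    (hu : ∀ k, ∀ x ∈ Icc (0 : ℝ) 1, ∀ t j, ev (u k) x t j = G (p k) x t j)
    (hv : ∀ x ∈ Icc (0 : ℝ) 1, ∀ t j, ev v x t j = G p0 x t j) :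
    Tendsto u atTop (𝓝 v) := by
  rw [tendsto_iff_norm_sub_tendsto_zero, Metric.tendsto_nhds]
  intro ε hε
  have hK : IsCompact (Icc (0 : ℝ) 1 ×ˢ Icc (0 : ℝ) (2 * π)) := isCompact_Icc.prod isCompact_Icc
  have key : ∀ j, ∀ᶠ q in 𝓝 p0, ∀ y ∈ Icc (0 : ℝ) 1 ×ˢ Icc (0 : ℝ) (2 * π),
      |G q y.1 y.2 j - G p0 y.1 y.2 j| < ε / 2 := fun j => by
    refine hK.eventually_forall_of_forall_eventually fun y _ => ?_
    have hc : Continuous fun z : (ℝ × ℝ) × ℝ × ℝ =>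
        |G z.1 z.2.1 z.2.2 j - G p0 z.2.1 z.2.2 j| :=
      ((hG j).sub ((hG j).comp (continuous_const.prodMk continuous_snd))).abs
    exact hc.continuousAt.eventually (gt_mem_nhds (by simpa using half_pos hε))
  filter_upwards [hp.eventually (eventually_all.2 key)] with k hk
  rw [Real.dist_eq, sub_zero, abs_norm]
  refine (norm_le_of_abs_ev_le (half_pos hε).le fun x hx t ht j => ?_).trans_lt (half_lt_self hε)
  rw [ev_sub, Pi.sub_apply, hu k x hx, hv x hx]
  exact (hk j (x, t) ⟨hx, ht⟩).le

end Evaluation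

namespace HypData

variable {n m : ℕ} (d : HypData n m)

/-- `c` carries the coefficients of `d`, expressed along characteristics, on the strip
`x ∈ [0,1]`, `|λ| ≤ δ`. -/
structure IsCharCoeffs (c : CharCoeffs n) (δ : ℝ) : Prop where
  A_eq : ∀ j, ∀ x ∈ Icc (0 : ℝ) 1, ∀ lam ∈ Icc (-δ) δ, c.A j x lam = (d.a j x lam)⁻¹
  G_eq : ∀ j, ∀ x ∈ Icc (0 : ℝ) 1, ∀ lam ∈ Icc (-δ) δ,
    c.G j x lam = d.dbu j j x lam / d.a j x lam
  D_eq : ∀ j k, ∀ x ∈ Icc (0 : ℝ) 1, ∀ lam ∈ Icc (-δ) δ,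
    c.D j k x lam = (d.a j x lam)⁻¹ * if k ≠ j then -d.dbu j k x lam else 0
  X_eq : ∀ j, c.X j = xjv m j
  r_eq : ∀ j k, c.r j k = if (j : ℕ) < m then (if m ≤ (k : ℕ) then d.r j k else 0)
    else if (k : ℕ) < m then d.r j k else 0

theorem xjv_mem (j : Fin n) : xjv m j ∈ Icc (0 : ℝ) 1 := by
  unfold xjv
  split_ifs <;> simp

variable {d} {δ0 : ℝ}

theorem StandingHyps.continuous_a (h : d.StandingHyps δ0) (j : Fin n) :
    Continuous fun p : ℝ × ℝ => d.a j p.1 p.2 := (h.2.2.1 j).continuous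

theorem StandingHyps.continuous_fderiv_b (h : d.StandingHyps δ0) (j : Fin n) :
    Continuous fun p : (ℝ × ℝ) × (Fin n → ℝ) => fderiv ℝ (d.b j p.1.1 p.1.2) p.2 := by
  have hb := h.2.2.2.1 j
  have hb' : ContDiff ℝ (⊤ : ℕ∞) (Function.uncurry
      fun (p : (ℝ × ℝ) × (Fin n → ℝ)) (v : Fin n → ℝ) => d.b j p.1.1 p.1.2 v) :=
    hb.comp (by fun_prop :
      ContDiff ℝ (⊤ : ℕ∞) fun q : ((ℝ × ℝ) × (Fin n → ℝ)) × (Fin n → ℝ) =>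
        (q.1.1.1, q.1.1.2, q.2))
  exact (ContDiff.fderiv (n := 0) hb' (by fun_prop : ContDiff ℝ 0
    fun p : (ℝ × ℝ) × (Fin n → ℝ) => p.2) (by simp)).continuous

theorem StandingHyps.differentiable_b (h : d.StandingHyps δ0) (j : Fin n) (x lam : ℝ) :
    Differentiable ℝ (d.b j x lam) :=
  ((h.2.2.2.1 j).comp (by fun_prop : ContDiff ℝ (⊤ : ℕ∞) fun v : Fin n → ℝ => (x, lam, v))
    ).differentiable (by simp)

theorem StandingHyps.continuous_b (h : d.StandingHyps δ0) (j : Fin n) :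
    Continuous fun p : ℝ × ℝ × (Fin n → ℝ) => d.b j p.1 p.2.1 p.2.2 := (h.2.2.2.1 j).continuous

theorem StandingHyps.continuous_dbu (h : d.StandingHyps δ0) (j k : Fin n) :
    Continuous fun p : ℝ × ℝ => d.dbu j k p.1 p.2 :=
  ((h.continuous_fderiv_b j).comp (f := fun p : ℝ × ℝ => (p, (0 : Fin n → ℝ)))
    (by fun_prop)).clm_apply continuous_const

theorem StandingHyps.exists_strip (h : d.StandingHyps δ0) : ∃ δ > 0, ∀ j k, j ≠ k →
    ∀ x ∈ Icc (0 : ℝ) 1, ∀ lam ∈ Icc (-δ) δ, d.a j x lam ≠ d.a k x lam := by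
  have key : ∀ j k, ∀ᶠ lam in 𝓝 (0 : ℝ), j ≠ k → ∀ x ∈ Icc (0 : ℝ) 1,
      d.a j x lam ≠ d.a k x lam := fun j k => by
    by_cases hjk : j = k
    · simp [hjk]
    have := isCompact_Icc.eventually_forall_of_forall_eventually
      (x₀ := (0 : ℝ)) (K := Icc (0 : ℝ) 1)
      (P := fun lam x => d.a j x lam ≠ d.a k x lam) fun x hx => by
        have h1 : Continuous fun z : ℝ × ℝ => d.a j z.2 z.1 :=
          (h.continuous_a j).comp continuous_swap
        have h2 : Continuous fun z : ℝ × ℝ => d.a k z.2 z.1 :=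
          (h.continuous_a k).comp continuous_swap
        exact (isOpen_ne_fun h1 h2).mem_nhds (h.2.2.2.2.2.1 j k hjk x hx)
    filter_upwards [this] with lam hl _ using hl
  obtain ⟨ε, hε, hball⟩ := Metric.eventually_nhds_iff.1
    (eventually_all.2 fun j => eventually_all.2 (key j))
  refine ⟨ε / 2, half_pos hε, fun j k hjk x hx lam hl => hball ?_ j k hjk x hx⟩
  rw [Real.dist_eq, sub_zero, abs_lt]
  constructor <;> linarith [hl.1, hl.2]

theorem StandingHyps.exists_charCoeffs (h : d.StandingHyps δ0) :
    ∃ δ > 0, ∃ c : CharCoeffs n, δ ≤ δ0 ∧ d.IsCharCoeffs c δ := by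
  obtain ⟨δ', hδ', hne⟩ := h.exists_strip
  have hδ0 : 0 < δ0 := h.2.2.2.2.2.2.2.1
  have hne0 := h.2.2.2.2.2.2.2.2
  set δ := min δ' δ0 with hδ
  have hδpos : 0 < δ := lt_min hδ' hδ0
  have hsub' : Icc (-δ) δ ⊆ Icc (-δ') δ' :=
    Icc_subset_Icc (neg_le_neg (min_le_left _ _)) (min_le_left _ _)
  have hsub0 : Icc (-δ) δ ⊆ Icc (-δ0) δ0 :=
    Icc_subset_Icc (neg_le_neg (min_le_right _ _)) (min_le_right _ _)
  set X : ℝ → ℝ := fun x => max 0 (min 1 x) with hX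
  set Λ : ℝ → ℝ := fun lam => max (-δ) (min δ lam) with hΛ
  have hXm : ∀ x, X x ∈ Icc (0 : ℝ) 1 := fun x =>
    ⟨le_max_left _ _, max_le zero_le_one (min_le_left _ _)⟩
  have hΛm : ∀ lam, Λ lam ∈ Icc (-δ) δ := fun lam =>
    ⟨le_max_left _ _, max_le (by linarith) (min_le_left _ _)⟩
  have hXe : ∀ x ∈ Icc (0 : ℝ) 1, X x = x := fun x hx => by simp [hX, hx.1, hx.2]
  have hΛe : ∀ lam ∈ Icc (-δ) δ, Λ lam = lam := fun lam hl => by simp [hΛ, hl.1, hl.2]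
  have hXΛ : Continuous fun p : ℝ × ℝ => (X p.1, Λ p.2) := by fun_prop
  have ha : ∀ j, Continuous fun p : ℝ × ℝ => (d.a j (X p.1) (Λ p.2))⁻¹ := fun j =>
    ((h.continuous_a j).comp hXΛ).inv₀ fun p => hne0 j _ (hXm _) _ (hsub0 (hΛm _))
  have hb : ∀ j k, Continuous fun p : ℝ × ℝ => d.dbu j k (X p.1) (Λ p.2) := fun j k =>
    (h.continuous_dbu j k).comp hXΛ
  refine ⟨δ, hδpos,
    { A := fun j x lam => (d.a j (X x) (Λ lam))⁻¹
      G := fun j x lam => d.dbu j j (X x) (Λ lam) * (d.a j (X x) (Λ lam))⁻¹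
      D := fun j k x lam => (d.a j (X x) (Λ lam))⁻¹ *
        if k ≠ j then -d.dbu j k (X x) (Λ lam) else 0
      X := xjv m
      r := fun j k => if (j : ℕ) < m then (if m ≤ (k : ℕ) then d.r j k else 0)
        else if (k : ℕ) < m then d.r j k else 0
      continuous_A := ha
      continuous_G := fun j => (hb j j).mul (ha j)
      continuous_D := fun j k => by
        split_ifs
        · exact (ha j).mul (hb j k).neg
        · exact (ha j).mul continuous_const
      X_mem := xjv_mem
      A_ne := fun j k hjk x lam =>
        inv_injective.ne (hne j k hjk _ (hXm _) _ (hsub' (hΛm _)))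
      D_diag := fun j x lam => by simp }, min_le_right _ _, ?_⟩
  constructor
  · intro j x hx lam hl
    simp only [hXe x hx, hΛe lam hl]
  · intro j x hx lam hl
    simp only [hXe x hx, hΛe lam hl, div_eq_mul_inv]
  · intro j k x hx lam hl
    simp only [hXe x hx, hΛe lam hl]
  · exact fun _ => rfl
  · exact fun _ _ => rfl

namespace IsCharCoeffs

variable {c : CharCoeffs n} {δ lam x ξ : ℝ}

theorem tau_eq (hc : d.IsCharCoeffs c δ) (hl : lam ∈ Icc (-δ) δ)
    (hx : x ∈ Icc (0 : ℝ) 1) (hξ : ξ ∈ Icc (0 : ℝ) 1) (t ω : ℝ) (j : Fin n) :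
    d.tau j ξ x t lam ω = t + ω * (c.phase j ξ lam - c.phase j x lam) := by
  have hA := c.continuous_A_left j lam
  rw [tau, CharCoeffs.phase, CharCoeffs.phase, intervalIntegral.integral_interval_sub_left
    (hA.intervalIntegrable _ _) (hA.intervalIntegrable _ _), add_comm]
  congr 2
  exact intervalIntegral.integral_congr fun η hη =>
    (hc.A_eq j η (uIcc_subset_Icc hx hξ hη) lam hl).symm

theorem integral_G_eq (hc : d.IsCharCoeffs c δ) (hl : lam ∈ Icc (-δ) δ)
    (hx : x ∈ Icc (0 : ℝ) 1) (hξ : ξ ∈ Icc (0 : ℝ) 1) (j : Fin n) :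
    ∫ η in x..ξ, d.dbu j j η lam / d.a j η lam = c.logw j ξ lam - c.logw j x lam := by
  have hG : Continuous fun x => c.G j x lam :=
    (c.continuous_G j).comp (by fun_prop : Continuous fun x : ℝ => (x, lam))
  rw [CharCoeffs.logw, CharCoeffs.logw, intervalIntegral.integral_interval_sub_left
    (hG.intervalIntegrable _ _) (hG.intervalIntegrable _ _)]
  exact intervalIntegral.integral_congr fun η hη =>
    (hc.G_eq j η (uIcc_subset_Icc hx hξ hη) lam hl).symm

theorem cfac_eq (hc : d.IsCharCoeffs c δ) (hl : lam ∈ Icc (-δ) δ)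
    (hx : x ∈ Icc (0 : ℝ) 1) (hξ : ξ ∈ Icc (0 : ℝ) 1) (j : Fin n) :
    d.cfac j ξ x lam = Real.exp (c.logw j ξ lam - c.logw j x lam) := by
  rw [cfac, hc.integral_G_eq hl hx hξ]

theorem copRaw_eq (hc : d.IsCharCoeffs c δ) (hl : lam ∈ Icc (-δ) δ)
    (hx : x ∈ Icc (0 : ℝ) 1) (ω t : ℝ) (U : ℝ → ℝ → Fin n → ℝ) (j : Fin n) :
    d.CopRaw lam ω U x t j = c.refl lam ω U x t j := by
  have h0 : (0 : ℝ) ∈ Icc (0 : ℝ) 1 := by simp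
  have h1 : (1 : ℝ) ∈ Icc (0 : ℝ) 1 := by simp
  simp only [CopRaw, CharCoeffs.refl, hc.X_eq, hc.r_eq, xjv, hc.cfac_eq hl hx h0,
    hc.cfac_eq hl hx h1, hc.tau_eq hl hx h0, hc.tau_eq hl hx h1]
  split_ifs <;> simp only [ite_mul, zero_mul]

theorem fopRaw_eq (hc : d.IsCharCoeffs c δ) (hl : lam ∈ Icc (-δ) δ)
    (hx : x ∈ Icc (0 : ℝ) 1) (ω t : ℝ) (U : ℝ → ℝ → Fin n → ℝ) (j : Fin n) :
    d.FopRaw lam ω U x t j = ∫ ξ in (c.X j)..x,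
      Real.exp (c.logw j ξ lam - c.logw j x lam) * (c.A j ξ lam * d.ffun j ξ lam
        (U ξ (t + ω * (c.phase j ξ lam - c.phase j x lam)))) := by
  rw [FopRaw, ← hc.X_eq]
  refine intervalIntegral.integral_congr fun ξ hξ => ?_
  have hξ' := uIcc_subset_Icc (c.X_mem j) hx hξ
  simp only [hc.cfac_eq hl hx hξ', hc.tau_eq hl hx hξ', hc.A_eq j ξ hξ' lam hl, div_eq_mul_inv,
    mul_assoc]

end IsCharCoeffs

end HypData

namespace HypData

variable {n m : ℕ} {d : HypData n m} {δ0 : ℝ}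

theorem fderiv_b_apply (j : Fin n) (x lam : ℝ) (z : Fin n → ℝ) :
    fderiv ℝ (d.b j x lam) 0 z = ∑ k, d.dbu j k x lam * z k := by
  conv_lhs => rw [pi_eq_sum_univ' z]
  simp only [map_sum, map_smul, smul_eq_mul, dbu, mul_comm]

/-- The coupling terms are uniformly close to their linearization at `0`. -/
theorem StandingHyps.abs_ffun_sub_sub_le (h : d.StandingHyps δ0) (δ : ℝ) {ε : ℝ} (hε : 0 < ε) :
    ∃ ρ > 0, ∀ x ∈ Icc (0 : ℝ) 1, ∀ lam ∈ Icc (-δ) δ, ∀ j, ∀ v z : Fin n → ℝ, ‖v‖ < ρ →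
      ‖v + z‖ < ρ → |d.ffun j x lam (v + z) - d.ffun j x lam v -
        ∑ k, (if k ≠ j then -d.dbu j k x lam else 0) * z k| ≤ ε * ‖z‖ := by
  have key : ∀ j, ∀ᶠ v in 𝓝 (0 : Fin n → ℝ), ∀ p ∈ Icc (0 : ℝ) 1 ×ˢ Icc (-δ) δ,
      ‖fderiv ℝ (d.b j p.1 p.2) v - fderiv ℝ (d.b j p.1 p.2) 0‖ < ε := fun j => by
    refine (isCompact_Icc.prod isCompact_Icc).eventually_forall_of_forall_eventually
      fun p _ => ?_
    have h1 := h.continuous_fderiv_b j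
    have hc : Continuous fun z : (Fin n → ℝ) × ℝ × ℝ =>
        ‖fderiv ℝ (d.b j z.2.1 z.2.2) z.1 - fderiv ℝ (d.b j z.2.1 z.2.2) 0‖ :=
      ((h1.comp (f := fun z : (Fin n → ℝ) × ℝ × ℝ => (z.2, z.1)) (by fun_prop)).sub
        (h1.comp (f := fun z : (Fin n → ℝ) × ℝ × ℝ => (z.2, (0 : Fin n → ℝ)))
          (by fun_prop))).norm
    exact hc.continuousAt.eventually (gt_mem_nhds (by simpa using hε))
  obtain ⟨ρ, hρ, hball⟩ := Metric.eventually_nhds_iff.1 (eventually_all.2 key)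
  refine ⟨ρ, hρ, fun x hx lam hl j v z hv hvz => ?_⟩
  have hmv := Convex.norm_image_sub_le_of_norm_hasFDerivWithin_le' (f := d.b j x lam)
    (f' := fun v => fderiv ℝ (d.b j x lam) v) (φ := fderiv ℝ (d.b j x lam) 0) (C := ε)
    (s := Metric.ball 0 ρ) (x := v) (y := v + z)
    (fun y _ => (h.differentiable_b j x lam y).hasFDerivAt.hasFDerivWithinAt)
    (fun y hy => (hball hy j (x, lam) ⟨hx, hl⟩).le) (convex_ball _ _)
    (by simpa using hv) (by simpa using hvz)
  rw [add_sub_cancel_left, fderiv_b_apply, Real.norm_eq_abs, abs_sub_comm] at hmv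
  refine (le_of_eq ?_).trans hmv
  congr 1
  have hsum : ∑ k, (if k ≠ j then -d.dbu j k x lam else 0) * z k =
      d.dbu j j x lam * z j - ∑ k, d.dbu j k x lam * z k := by
    rw [eq_sub_iff_add_eq, ← Finset.sum_add_distrib, Finset.sum_eq_single j]
    · simp
    · intro k _ hk
      simp [hk]
    · simp
  rw [hsum]
  simp only [ffun, Pi.add_apply]
  ring

variable {c : CharCoeffs n} {δ : ℝ}

theorem StandingHyps.continuous_fopRaw_integrand (h : d.StandingHyps δ0)
    {U : ℝ → ℝ → Fin n → ℝ} (hU : Continuous fun p : ℝ × ℝ => U p.1 p.2) (lam ω x t : ℝ)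
    (j : Fin n) : Continuous fun ξ => Real.exp (c.logw j ξ lam - c.logw j x lam) *
      (c.A j ξ lam * d.ffun j ξ lam (U ξ (t + ω * (c.phase j ξ lam - c.phase j x lam)))) := by
  have h1 := c.continuous_logw_left j lam
  have h2 := c.continuous_phase_left j lam
  have h3 := c.continuous_A_left j lam
  have h4 : Continuous fun ξ => U ξ (t + ω * (c.phase j ξ lam - c.phase j x lam)) :=
    hU.comp (f := fun ξ => (ξ, t + ω * (c.phase j ξ lam - c.phase j x lam))) (by fun_prop)
  have h5 : Continuous fun ξ =>
      d.b j ξ lam (U ξ (t + ω * (c.phase j ξ lam - c.phase j x lam))) :=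
    (h.continuous_b j).comp (f := fun ξ => (ξ, lam, _)) (by fun_prop)
  have h6 : Continuous fun ξ => d.dbu j j ξ lam :=
    (h.continuous_dbu j j).comp (by fun_prop : Continuous fun ξ : ℝ => (ξ, lam))
  unfold ffun
  fun_prop

theorem _root_.CharCoeffs.continuous_vol_integrand {U : ℝ → ℝ → Fin n → ℝ}
    (hU : Continuous fun p : ℝ × ℝ => U p.1 p.2) (lam ω x t : ℝ) (j : Fin n) :
    Continuous fun ξ => Real.exp (c.logw j ξ lam - c.logw j x lam) *
      ∑ k, c.D j k ξ lam * U ξ (t + ω * (c.phase j ξ lam - c.phase j x lam)) k := by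
  have h1 := c.continuous_logw_left j lam
  have h2 := c.continuous_phase_left j lam
  have h3 := fun k => c.continuous_D_left j k lam
  have h4 : Continuous fun ξ => U ξ (t + ω * (c.phase j ξ lam - c.phase j x lam)) :=
    hU.comp (f := fun ξ => (ξ, t + ω * (c.phase j ξ lam - c.phase j x lam))) (by fun_prop)
  fun_prop

/-- The derivative of `F(λ,ω,·)` near `0` is uniformly close to the linear integral operator. -/
theorem IsCharCoeffs.exists_abs_ev_fderiv_sub_vol_le (hc : d.IsCharCoeffs c δ)
    (h : d.StandingHyps δ0) {ε : ℝ} (hε : 0 < ε) :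
    ∃ ρ > 0, ∀ lam ∈ Icc (-δ) δ, ∀ ω, ∀ F : Cspace n → Cspace n,
      (∀ u, ∀ x ∈ Icc (0 : ℝ) 1, ∀ t j, ev (F u) x t j = d.FopRaw lam ω (ev u) x t j) →
      ∀ u, ∀ L : Cspace n →L[ℝ] Cspace n, HasFDerivAt F L u → ‖u‖ < ρ →
      ∀ w, ∀ x ∈ Icc (0 : ℝ) 1, ∀ t j,
        |ev (L w) x t j - c.vol lam ω (ev w) x t j| ≤ ε * ‖w‖ := by
  obtain ⟨K, hK0, hK⟩ := c.exists_bounds δ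
  set ε' : ℝ := ε / (K * K * K + 1) with hε'
  have hε'pos : 0 < ε' := by positivity
  obtain ⟨ρ, hρ, hf⟩ := h.abs_ffun_sub_sub_le δ hε'pos
  refine ⟨ρ, hρ, fun lam hl ω F hF u L hL hu w x hx t j => ?_⟩
  set V := c.vol lam ω (ev w) x t j with hV
  have hpath : HasDerivAt (fun s : ℝ => u + s • w) w 0 := by
    simpa using ((hasDerivAt_id (0 : ℝ)).smul_const w).const_add u
  have hFd : HasDerivAt (fun s : ℝ => F (u + s • w)) (L w) 0 :=
    HasFDerivAt.comp_hasDerivAt (0 : ℝ) (by simpa using hL) hpath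
  let e : Cspace n →L[ℝ] ℝ := (ContinuousLinearMap.proj j).comp
    (ContinuousMap.evalCLM ℝ (projIcc (0 : ℝ) 1 zero_le_one x, (t : TimeCircle)))
  have he : ∀ z : Cspace n, e z = ev z x t j := fun z => rfl
  have hg : HasDerivAt (fun s : ℝ => ev (F (u + s • w)) x t j - s * V) (ev (L w) x t j - V) 0 := by
    have h1 : HasDerivAt (fun s : ℝ => e (F (u + s • w)) - s * V) (e (L w) - 1 * V) 0 :=
      (e.hasFDerivAt.comp_hasDerivAt (0 : ℝ) hFd).sub ((hasDerivAt_id (0 : ℝ)).mul_const V)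
    simpa [he] using h1
  have hsmall : ∀ᶠ s in 𝓝 (0 : ℝ), ‖u + s • w‖ < ρ := by
    refine (hpath.continuousAt.norm).eventually (gt_mem_nhds (by simpa using hu))
  refine hg.le_of_lip' (by positivity) ?_
  filter_upwards [hsmall] with s hs
  have hUs := continuous_ev (u + s • w)
  have hU := continuous_ev u
  have hW := continuous_ev w
  simp only [zero_smul, add_zero, zero_mul, sub_zero]
  rw [hF _ x hx, hF _ x hx, hc.fopRaw_eq hl hx, hc.fopRaw_eq hl hx, hV, CharCoeffs.vol,
    ← intervalIntegral.integral_const_mul, sub_right_comm,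
    ← intervalIntegral.integral_sub
      ((h.continuous_fopRaw_integrand hUs lam ω x t j).intervalIntegrable _ _)
      ((h.continuous_fopRaw_integrand hU lam ω x t j).intervalIntegrable _ _),
    ← intervalIntegral.integral_sub
      (((h.continuous_fopRaw_integrand hUs lam ω x t j).fun_sub
        (h.continuous_fopRaw_integrand hU lam ω x t j)).intervalIntegrable _ _)
      (((c.continuous_vol_integrand hW lam ω x t j).const_mul s).intervalIntegrable _ _)]
  have hbound : ∀ ξ ∈ Icc (0 : ℝ) 1, |Real.exp (c.logw j ξ lam - c.logw j x lam) *
      (c.A j ξ lam * d.ffun j ξ lam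
        (ev (u + s • w) ξ (t + ω * (c.phase j ξ lam - c.phase j x lam)))) -
      Real.exp (c.logw j ξ lam - c.logw j x lam) * (c.A j ξ lam * d.ffun j ξ lam
        (ev u ξ (t + ω * (c.phase j ξ lam - c.phase j x lam)))) -
      s * (Real.exp (c.logw j ξ lam - c.logw j x lam) *
        ∑ k, c.D j k ξ lam * ev w ξ (t + ω * (c.phase j ξ lam - c.phase j x lam)) k)| ≤
      K * K * K * (ε' * (‖w‖ * |s|)) := fun ξ hξ => by
    set τ := t + ω * (c.phase j ξ lam - c.phase j x lam)
    have h1 := hf ξ hξ lam hl j (ev u ξ τ) (s • ev w ξ τ) ((norm_ev_le _ _ _).trans_lt hu)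
      ((norm_ev_le (u + s • w) ξ τ).trans_lt hs)
    have h2 : ‖s • ev w ξ τ‖ ≤ ‖w‖ * |s| := by
      rw [norm_smul, mul_comm, Real.norm_eq_abs]
      exact mul_le_mul_of_nonneg_right (norm_ev_le _ _ _) (abs_nonneg _)
    have h3 := h1.trans (mul_le_mul_of_nonneg_left h2 hε'pos.le)
    obtain ⟨b1, b2, -, -⟩ := hK ξ hξ lam hl j j
    obtain ⟨-, -, b3, -⟩ := hK x hx lam hl j j
    have hsum : s * ∑ k, c.D j k ξ lam * ev w ξ τ k = c.A j ξ lam *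
        ∑ k, (if k ≠ j then -d.dbu j k ξ lam else 0) * (s • ev w ξ τ) k := by
      rw [Finset.mul_sum, Finset.mul_sum]
      refine Finset.sum_congr rfl fun k _ => ?_
      rw [hc.D_eq j k ξ hξ lam hl, hc.A_eq j ξ hξ lam hl, Pi.smul_apply, smul_eq_mul]
      ring
    rw [mul_left_comm s, hsum, ← mul_sub, ← mul_sub, ← mul_sub, ← mul_sub, abs_mul, abs_mul,
      Real.abs_exp, sub_eq_add_neg (c.logw j ξ lam), Real.exp_add, ← mul_assoc]
    gcongr
    exact h3
  rw [Real.norm_eq_abs, Real.norm_eq_abs]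
  refine (CharCoeffs.abs_integral_le_of_unit (c.X_mem j) hx hbound).trans ?_
  have hlen : |x - c.X j| ≤ 1 := by
    have := c.X_mem j
    rw [abs_le]
    constructor <;> linarith [hx.1, hx.2, this.1, this.2]
  refine (mul_le_of_le_one_right (by positivity) hlen).trans ?_
  have : K * K * K * ε' ≤ ε := by
    rw [hε', mul_div_assoc', div_le_iff₀ (by positivity)]
    nlinarith
  calc K * K * K * (ε' * (‖w‖ * |s|)) = K * K * K * ε' * (‖w‖ * |s|) := by ring
    _ ≤ ε * (‖w‖ * |s|) := by gcongr
    _ = ε * ‖w‖ * |s| := by ring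

end HypData

namespace CharCoeffs

variable {n : ℕ} (c : CharCoeffs n)

/-- The gain of the `j`-th reflected component. -/
noncomputable def gain (j : Fin n) (x lam : ℝ) : ℝ :=
  Real.exp (c.logw j (c.X j) lam - c.logw j x lam) * ∑ k, |c.r j k|

theorem continuous_gain (j : Fin n) : Continuous fun p : ℝ × ℝ => c.gain j p.1 p.2 := by
  have h1 := c.continuous_logw j
  have h2 : Continuous fun p : ℝ × ℝ => c.logw j (c.X j) p.2 :=
    h1.comp (f := fun p : ℝ × ℝ => (c.X j, p.2)) (by fun_prop)
  unfold gain
  fun_prop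

theorem abs_refl_le (lam ω x t : ℝ) (j : Fin n) {U : ℝ → ℝ → Fin n → ℝ} {B : ℝ}
    (hU : ∀ k, c.r j k ≠ 0 → ∀ σ, |U (c.X j) σ k| ≤ B) :
    |c.refl lam ω U x t j| ≤ c.gain j x lam * B := by
  rw [refl, gain, abs_mul, Real.abs_exp, mul_assoc, Finset.sum_mul]
  gcongr
  refine (Finset.abs_sum_le_sum_abs _ _).trans (Finset.sum_le_sum fun k _ => ?_)
  rw [abs_mul]
  by_cases hr : c.r j k = 0
  · simp [hr]
  · exact mul_le_mul_of_nonneg_left (hU k hr _) (abs_nonneg _)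

theorem eventually_gain_le {η : ℝ} (hη : 0 < η) : ∀ᶠ lam in 𝓝 (0 : ℝ),
    ∀ j, ∀ x ∈ Icc (0 : ℝ) 1, c.gain j x lam ≤ c.gain j x 0 + η := by
  refine eventually_all.2 fun j => ?_
  refine isCompact_Icc.eventually_forall_of_forall_eventually fun x _ => ?_
  have h1 : Continuous fun z : ℝ × ℝ => c.gain j z.2 z.1 :=
    (c.continuous_gain j).comp continuous_swap
  have h2 : Continuous fun z : ℝ × ℝ => c.gain j z.2 0 :=
    (c.continuous_gain j).comp (f := fun z : ℝ × ℝ => (z.2, (0 : ℝ))) (by fun_prop)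
  have h3 : Continuous fun z : ℝ × ℝ => c.gain j z.2 z.1 - c.gain j z.2 0 := h1.sub h2
  filter_upwards [h3.continuousAt.eventually (gt_mem_nhds (by simpa using hη) :
    ∀ᶠ y in 𝓝 (c.gain j x 0 - c.gain j x 0), y < η)] with z hz
  linarith

end CharCoeffs

namespace HypData

variable {n m : ℕ} {d : HypData n m} {c : CharCoeffs n} {δ : ℝ}

theorem IsCharCoeffs.gain_zero_le_R0c (hc : d.IsCharCoeffs c δ) (hδ : 0 ≤ δ) {j : Fin n}
    (hj : (j : ℕ) < m) {x : ℝ} (hx : x ∈ Icc (0 : ℝ) 1) : c.gain j x 0 ≤ d.R0c := by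
  have hl : (0 : ℝ) ∈ Icc (-δ) δ := ⟨by linarith, hδ⟩
  have h0 : (0 : ℝ) ∈ Icc (0 : ℝ) 1 := by simp
  have key : ∀ j : Fin n, (j : ℕ) < m → ∀ x ∈ Icc (0 : ℝ) 1,
      (∑ k : Fin n, (if m ≤ (k : ℕ) then
        |d.r j k| * Real.exp (-∫ η in (0:ℝ)..x, d.dbu j j η 0 / d.a j η 0) else 0)) =
      c.gain j x 0 := fun j hj x hx => by
    rw [hc.integral_G_eq hl h0 hx, CharCoeffs.gain, hc.X_eq, Finset.mul_sum, neg_sub, xjv,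
      if_pos hj]
    refine Finset.sum_congr rfl fun k _ => ?_
    rw [hc.r_eq, if_pos hj]
    split_ifs <;> simp [mul_comm]
  obtain ⟨K, -, hK⟩ := exists_abs_le_on_strip_of_fintype c.continuous_gain δ
  refine le_csSup ⟨K, ?_⟩ ⟨j, hj, x, hx, (key j hj x hx).symm⟩
  rintro y ⟨j, hj, x, hx, rfl⟩
  rw [key j hj x hx]
  exact (le_abs_self _).trans (hK j x hx 0 hl)

theorem IsCharCoeffs.gain_zero_le_R1c (hc : d.IsCharCoeffs c δ) (hδ : 0 ≤ δ) {j : Fin n}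
    (hj : m ≤ (j : ℕ)) {x : ℝ} (hx : x ∈ Icc (0 : ℝ) 1) : c.gain j x 0 ≤ d.R1c := by
  have hl : (0 : ℝ) ∈ Icc (-δ) δ := ⟨by linarith, hδ⟩
  have h0 : (1 : ℝ) ∈ Icc (0 : ℝ) 1 := by simp
  have key : ∀ j : Fin n, m ≤ (j : ℕ) → ∀ x ∈ Icc (0 : ℝ) 1,
      (∑ k : Fin n, (if (k : ℕ) < m then
        |d.r j k| * Real.exp (∫ η in x..(1:ℝ), d.dbu j j η 0 / d.a j η 0) else 0)) =
      c.gain j x 0 := fun j hj x hx => by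
    rw [hc.integral_G_eq hl hx h0, CharCoeffs.gain, hc.X_eq, Finset.mul_sum, xjv,
      if_neg hj.not_gt]
    refine Finset.sum_congr rfl fun k _ => ?_
    rw [hc.r_eq, if_neg hj.not_gt]
    split_ifs <;> simp [mul_comm]
  obtain ⟨K, -, hK⟩ := exists_abs_le_on_strip_of_fintype c.continuous_gain δ
  refine le_csSup ⟨K, ?_⟩ ⟨j, hj, x, hx, (key j hj x hx).symm⟩
  rintro y ⟨j, hj, x, hx, rfl⟩
  rw [key j hj x hx]
  exact (le_abs_self _).trans (hK j x hx 0 hl)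

theorem R0c_nonneg (d : HypData n m) : 0 ≤ d.R0c := by
  refine Real.sSup_nonneg ?_
  rintro y ⟨j, -, x, -, rfl⟩
  exact Finset.sum_nonneg fun k _ => by split_ifs <;> positivity

theorem R1c_nonneg (d : HypData n m) : 0 ≤ d.R1c := by
  refine Real.sSup_nonneg ?_
  rintro y ⟨j, -, x, -, rfl⟩
  exact Finset.sum_nonneg fun k _ => by split_ifs <;> positivity

/-- Under dissipativity, `I - C(λ,ω)` is bounded below uniformly for small `λ`. -/
theorem IsCharCoeffs.exists_norm_le_mul_norm_sub (hc : d.IsCharCoeffs c δ) (hδ : 0 < δ)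
    (hdiss : d.R0c * d.R1c < 1) :
    ∃ δ' > 0, δ' ≤ δ ∧ ∃ M, 0 ≤ M ∧ ∀ lam ∈ Icc (-δ') δ', ∀ ω, ∀ L : Cspace n → Cspace n,
      (∀ u, ∀ x ∈ Icc (0 : ℝ) 1, ∀ t j, ev (L u) x t j = c.refl lam ω (ev u) x t j) →
      ∀ z, ‖z‖ ≤ M * ‖z - L z‖ := by
  obtain ⟨η, hη, hq⟩ : ∃ η > 0, (d.R0c + η) * (d.R1c + η) < 1 := by
    have hcont : Continuous fun η : ℝ => (d.R0c + η) * (d.R1c + η) := by fun_prop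
    have := hcont.continuousAt.eventually (gt_mem_nhds (by simpa using hdiss) :
      ∀ᶠ y in 𝓝 ((d.R0c + 0) * (d.R1c + 0)), y < 1)
    obtain ⟨ε, hε, hb⟩ := Metric.eventually_nhds_iff.1 this
    exact ⟨ε / 2, half_pos hε, hb (by simp [abs_of_pos hε, hε])⟩
  obtain ⟨ε, hε, hb⟩ := Metric.eventually_nhds_iff.1 (c.eventually_gain_le hη)
  set R0 := d.R0c + η
  set R1 := d.R1c + η
  have hR0 : 0 ≤ R0 := add_nonneg d.R0c_nonneg hη.le
  have hR1 : 0 ≤ R1 := add_nonneg d.R1c_nonneg hη.le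
  have hq' : 0 < 1 - R0 * R1 := sub_pos.2 hq
  refine ⟨min (ε / 2) δ, by positivity, min_le_right _ _,
    1 + (R1 + 1) * ((1 + R0) / (1 - R0 * R1)), by positivity, fun lam hl ω L hL z => ?_⟩
  have hgain : ∀ j, ∀ x ∈ Icc (0 : ℝ) 1, c.gain j x lam ≤ c.gain j x 0 + η := by
    refine hb ?_
    rw [Real.dist_eq, sub_zero, abs_lt]
    have := min_le_left (ε / 2) δ
    constructor <;> linarith [hl.1, hl.2]
  set H := ‖z - L z‖
  have hH : 0 ≤ H := norm_nonneg _
  have hstep : ∀ x ∈ Icc (0 : ℝ) 1, ∀ t j, |ev z x t j| ≤ H + |c.refl lam ω (ev z) x t j| :=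
    fun x hx t j => by
      have h1 := abs_ev_le (z - L z) x t j
      rw [ev_sub, Pi.sub_apply, hL z x hx] at h1
      have h2 := abs_sub_abs_le_abs_sub (ev z x t j) (c.refl lam ω (ev z) x t j)
      linarith
  set S : Set ℝ := {y | ∃ x ∈ Icc (0 : ℝ) 1, ∃ t, ∃ k : Fin n, (k : ℕ) < m ∧ y = |ev z x t k|}
  set A := sSup S
  have hA0 : 0 ≤ A := by
    refine Real.sSup_nonneg ?_
    rintro y ⟨x, -, t, k, -, rfl⟩
    exact abs_nonneg _
  have hA : ∀ x ∈ Icc (0 : ℝ) 1, ∀ t, ∀ k : Fin n, (k : ℕ) < m → |ev z x t k| ≤ A :=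
    fun x hx t k hk => by
      refine le_csSup ⟨‖z‖, ?_⟩ ⟨x, hx, t, k, hk, rfl⟩
      rintro y ⟨x, -, t, k, -, rfl⟩
      exact abs_ev_le _ _ _ _
  have hright : ∀ x ∈ Icc (0 : ℝ) 1, ∀ t, ∀ j : Fin n, m ≤ (j : ℕ) →
      |ev z x t j| ≤ H + R1 * A := fun x hx t j hj => by
    refine (hstep x hx t j).trans (add_le_add_right ?_ H)
    refine (c.abs_refl_le lam ω x t j (B := A) fun k hk σ => hA _ (c.X_mem j) _ _ ?_).trans
      (mul_le_mul_of_nonneg_right ((hgain j x hx).trans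
        (add_le_add_left (hc.gain_zero_le_R1c hδ.le hj hx) η)) hA0)
    by_contra hkm
    exact hk (by rw [hc.r_eq, if_neg hj.not_gt, if_neg hkm])
  have hleft : A ≤ (1 + R0) * H + R0 * R1 * A := by
    refine Real.sSup_le ?_ (by positivity)
    rintro y ⟨x, hx, t, j, hj, rfl⟩
    have h1 := c.abs_refl_le lam ω x t j (U := ev z) (B := H + R1 * A) fun k hk σ =>
      hright _ (c.X_mem j) _ _ (by
        by_contra hkm
        exact hk (by rw [hc.r_eq, if_pos hj, if_neg hkm]))
    have h2 : c.gain j x lam * (H + R1 * A) ≤ R0 * (H + R1 * A) :=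
      mul_le_mul_of_nonneg_right ((hgain j x hx).trans
        (add_le_add_left (hc.gain_zero_le_R0c hδ.le hj hx) η)) (by positivity)
    linarith [hstep x hx t j]
  have hA' : A ≤ (1 + R0) / (1 - R0 * R1) * H := by
    rw [div_mul_eq_mul_div, le_div_iff₀ hq']
    linarith
  refine norm_le_of_abs_ev_le (by positivity) fun x hx t _ j => ?_
  have hB := mul_le_mul_of_nonneg_left hA' (by positivity : 0 ≤ R1 + 1)
  have hC : 0 ≤ R1 * A := by positivity
  rcases lt_or_ge (j : ℕ) m with hj | hj
  · linarith [hA x hx t j hj]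
  · linarith [hright x hx t j hj]

end HypData

theorem apply_mk_eq_ev {n : ℕ} (u : Cspace n) {x : ℝ} (hx : x ∈ Icc (0 : ℝ) 1) (t : ℝ) :
    u (⟨x, hx⟩, (t : TimeCircle)) = ev u x t := by
  rw [ev, projIcc_of_mem zero_le_one hx]

/-- Nearby points of the circle have nearby representatives. -/
theorem exists_coe_eq_abs_sub_eq (θ : TimeCircle) (t₀ : ℝ) :
    ∃ t : ℝ, (t : TimeCircle) = θ ∧ |t - t₀| = dist θ t₀ := by
  obtain ⟨y, hy⟩ := QuotientAddGroup.mk_surjective (θ - (t₀ : TimeCircle))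
  have hy' : (y : TimeCircle) = θ - t₀ := hy
  refine ⟨t₀ + (y - round ((2 * π)⁻¹ * y) * (2 * π)), ?_, ?_⟩
  · have hz : ((round ((2 * π)⁻¹ * y) * (2 * π) : ℝ) : TimeCircle) = 0 := by
      rw [← zsmul_eq_mul, AddCircle.coe_zsmul, AddCircle.coe_period, smul_zero]
    rw [AddCircle.coe_add, AddCircle.coe_sub, hz, hy', sub_zero, add_sub_cancel]
  · rw [add_sub_cancel_left, dist_eq_norm, ← hy', AddCircle.norm_eq]

/-- A bounded, uniformly equicontinuous family of functions lies in a compact set. -/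
theorem exists_isCompact_of_modulus {n : ℕ} (T : Set (Cspace n)) (M : ℝ)
    (hM : ∀ g ∈ T, ‖g‖ ≤ M)
    (hT : ∀ ε > 0, ∃ η > 0, ∀ g ∈ T, ∀ x ∈ Icc (0 : ℝ) 1, ∀ x' ∈ Icc (0 : ℝ) 1, ∀ t t',
      |x - x'| < η → |t - t'| < η → ∀ j, |ev g x t j - ev g x' t' j| ≤ ε) :
    ∃ S, IsCompact S ∧ T ⊆ S := by
  let e := ContinuousMap.isometryEquivBoundedOfCompact Dom (Fin n → ℝ)
  have hcpt : IsCompact (closure (e '' T)) := by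
    refine BoundedContinuousFunction.arzela_ascoli (Metric.closedBall 0 M)
      (isCompact_closedBall _ _) _ ?_ ?_
    · rintro _ z ⟨g, hg, rfl⟩
      rw [mem_closedBall_zero_iff]
      exact (g.norm_coe_le_norm z).trans (hM g hg)
    · intro z₀
      obtain ⟨⟨x₀, hx₀⟩, θ₀⟩ := z₀
      obtain ⟨t₀, rfl⟩ := QuotientAddGroup.mk_surjective θ₀
      rw [Metric.equicontinuousAt_iff]
      intro ε hε
      obtain ⟨η, hη, h⟩ := hT (ε / 2) (half_pos hε)
      refine ⟨η, hη, fun z hz i => ?_⟩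
      obtain ⟨⟨x, hx⟩, θ⟩ := z
      obtain ⟨_, g, hg, rfl⟩ := i
      rw [Prod.dist_eq, max_lt_iff] at hz
      obtain ⟨t, rfl, ht⟩ := exists_coe_eq_abs_sub_eq θ t₀
      have h1 : |x - x₀| < η := hz.1
      have h2 : |t - t₀| < η := ht.trans_lt hz.2
      have h3 : dist (g (⟨x₀, hx₀⟩, (t₀ : TimeCircle))) (g (⟨x, hx⟩, (t : TimeCircle))) < ε := by
        rw [apply_mk_eq_ev, apply_mk_eq_ev, dist_comm, dist_eq_norm]
        refine lt_of_le_of_lt ?_ (half_lt_self hε)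
        rw [pi_norm_le_iff_of_nonneg (half_pos hε).le]
        exact fun j => h g hg x hx x₀ hx₀ t t₀ h1 h2 j
      exact h3
  refine ⟨e.symm '' closure (e '' T), hcpt.image e.symm.continuous, fun g hg => ?_⟩
  exact ⟨e g, subset_closure ⟨g, hg, rfl⟩, e.symm_apply_apply g⟩

namespace CharCoeffs

variable {n : ℕ} (c : CharCoeffs n)

/-- The functions `F(C y + F z)` with bounded `z` and `C y + F z` form a relatively compact set,
uniformly in the parameters. -/
theorem exists_isCompact_vol (δ R : ℝ) : ∃ S : Set (Cspace n), IsCompact S ∧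
    ∀ lam ∈ Icc (-δ) δ, ∀ ω ∈ Icc (1 / 2 : ℝ) (3 / 2), ∀ y z f g : Cspace n,
      ‖z‖ ≤ R → ‖f‖ ≤ R →
      (∀ x ∈ Icc (0 : ℝ) 1, ∀ t j,
        ev f x t j = c.refl lam ω (ev y) x t j + c.vol lam ω (ev z) x t j) →
      (∀ x ∈ Icc (0 : ℝ) 1, ∀ t j, ev g x t j = c.vol lam ω (ev f) x t j) → g ∈ S := by
  rcases lt_or_ge R 0 with hR | hR
  · exact ⟨∅, isCompact_empty, fun lam _ ω _ y z f g hz =>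
      absurd ((norm_nonneg z).trans hz) hR.not_ge⟩
  obtain ⟨K, hK0, hK⟩ := c.exists_bounds δ
  set T : Set (Cspace n) := {g | ∃ lam ∈ Icc (-δ) δ, ∃ ω ∈ Icc (1 / 2 : ℝ) (3 / 2),
    ∃ y z f : Cspace n, ‖z‖ ≤ R ∧ ‖f‖ ≤ R ∧
      (∀ x ∈ Icc (0 : ℝ) 1, ∀ t j,
        ev f x t j = c.refl lam ω (ev y) x t j + c.vol lam ω (ev z) x t j) ∧
      (∀ x ∈ Icc (0 : ℝ) 1, ∀ t j, ev g x t j = c.vol lam ω (ev f) x t j)}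
  obtain ⟨S, hS, hTS⟩ := exists_isCompact_of_modulus T (K * (n * (K * (K * R)))) (by
    rintro g ⟨lam, hl, ω, -, y, z, f, -, hf, -, hg⟩
    refine norm_le_of_abs_ev_le (by positivity) fun x hx t _ j => ?_
    rw [hg x hx, c.vol_eq_sum_volPart (continuous_ev f), abs_mul, Real.abs_exp]
    have hsum : |∑ k, c.volPart lam ω (ev f) j k x (t - ω * c.phase j x lam)| ≤
        n * (K * (K * R)) :=
      (Finset.abs_sum_le_sum_abs _ _).trans ((Finset.sum_le_sum fun k _ =>
        c.abs_volPart_le hK0 hK hl hR (fun x t j => (abs_ev_le f x t j).trans hf) hx j k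
          _).trans (le_of_eq (by simp)))
    exact mul_le_mul (hK x hx lam hl j j).2.2.1 hsum (abs_nonneg _) hK0) (by
    intro ε hε
    choose η hη H using fun j => c.exists_modulus_vol hK0 hK hR j hε
    obtain ⟨η', hη', H'⟩ : ∃ η' > 0, ∀ j, η' ≤ η j := by
      rcases isEmpty_or_nonempty (Fin n) with he | he
      · exact ⟨1, one_pos, fun j => (he.false j).elim⟩
      · obtain ⟨j, hj⟩ := Finite.exists_min η
        exact ⟨η j, hη j, hj⟩
    refine ⟨η', hη', ?_⟩
    rintro g ⟨lam, hl, ω, hω, y, z, f, hz, hf, hfe, hg⟩ x hx x' hx' t t' hxx htt j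
    rw [hg x hx, hg x' hx']
    exact H j lam hl ω hω (ev f) (ev y) (ev z) (continuous_ev f)
      (fun x t j => (abs_ev_le f x t j).trans hf) (continuous_ev z)
      (fun x t j => (abs_ev_le z x t j).trans hz) hfe x hx x' hx' t t'
      (hxx.trans_le (H' j)) (htt.trans_le (H' j)))
  exact ⟨S, hS, fun lam hl ω hω y z f g hz hf hfe hg =>
    hTS ⟨lam, hl, ω, hω, y, z, f, hz, hf, hfe, hg⟩⟩

end CharCoeffs

namespace HypData

variable {n m : ℕ} {d : HypData n m} {c : CharCoeffs n} {δ δ0 : ℝ}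

theorem IsCharCoeffs.ev_fderiv_zero_eq_vol (hc : d.IsCharCoeffs c δ) (h : d.StandingHyps δ0)
    {lam : ℝ} (hl : lam ∈ Icc (-δ) δ) {ω : ℝ} {F : Cspace n → Cspace n}
    (hF : ∀ u, ∀ x ∈ Icc (0 : ℝ) 1, ∀ t j, ev (F u) x t j = d.FopRaw lam ω (ev u) x t j)
    {L : Cspace n →L[ℝ] Cspace n} (hL : HasFDerivAt F L 0) (w : Cspace n)
    {x : ℝ} (hx : x ∈ Icc (0 : ℝ) 1) (t : ℝ) (j : Fin n) :
    ev (L w) x t j = c.vol lam ω (ev w) x t j := by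
  rw [← sub_eq_zero, ← abs_nonpos_iff]
  refine le_of_forall_pos_le_add fun ε hε => ?_
  obtain ⟨ρ, hρ, H⟩ := hc.exists_abs_ev_fderiv_sub_vol_le h
    (by positivity : 0 < ε / (‖w‖ + 1))
  refine (H lam hl ω F hF 0 L hL (by simpa using hρ) w x hx t j).trans ?_
  rw [zero_add, div_mul_eq_mul_div, div_le_iff₀ (by positivity)]
  nlinarith [norm_nonneg w]

/-- The derivative of `F(λ,ω,·)` is continuous at `0` in operator norm, uniformly in `(λ,ω)`. -/
theorem IsCharCoeffs.exists_norm_fderiv_sub_le (hc : d.IsCharCoeffs c δ) (h : d.StandingHyps δ0)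
    {ε : ℝ} (hε : 0 < ε) : ∃ ρ > 0, ∀ lam ∈ Icc (-δ) δ, ∀ ω, ∀ F : Cspace n → Cspace n,
      (∀ u, ∀ x ∈ Icc (0 : ℝ) 1, ∀ t j, ev (F u) x t j = d.FopRaw lam ω (ev u) x t j) →
      ∀ u, ∀ L L₀ : Cspace n →L[ℝ] Cspace n, HasFDerivAt F L u → HasFDerivAt F L₀ 0 → ‖u‖ < ρ →
        ‖L - L₀‖ ≤ ε := by
  obtain ⟨ρ, hρ, H⟩ := hc.exists_abs_ev_fderiv_sub_vol_le h hε
  refine ⟨ρ, hρ, fun lam hl ω F hF u L L₀ hL hL₀ hu =>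
    ContinuousLinearMap.opNorm_le_bound _ hε.le fun w =>
      norm_le_of_abs_ev_le (by positivity) fun x hx t _ j => ?_⟩
  rw [sub_apply, ev_sub, Pi.sub_apply,
    hc.ev_fderiv_zero_eq_vol h hl hF hL₀ w hx]
  exact H lam hl ω F hF u L hL hu w x hx t j

end HypData

/-- **Uniform lower bound for the linearization on `ker Q`:**
there exist `δ₂ ∈ (0,δ₁)` and `c₂ > 0` such that for all `λ ∈ [−δ₂,δ₂]`,
`ω ∈ [1−δ₂,1+δ₂]`, `u ∈ C_n` with `‖u‖_∞ ≤ δ₂`, one has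
`‖(I−P)(I−C(λ,ω)−∂_uF(λ,ω,u))w‖_∞ ≥ c₂‖w‖_∞` for all `w ∈ ker Q`. -/
theorem lower_bound_on_kerQ {n m : ℕ} (d : HypData n m) (δ0 : ℝ)
    (hyp : d.StandingHyps δ0) (hdiss : d.R0c * d.R1c < 1)
    (h1 : d.HypH1) (h2 : d.HypH2) (h4 : d.HypH4)
    (v0 w0 : Fin n → ℝ → ℂ)
    (hv0 : d.IsEV 0 Complex.I v0) (hv0n : Nontriv v0)
    (hw0 : d.IsAEV 0 (-Complex.I) w0) (hw0n : Nontriv w0)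
    (hnorm : NormalizedPair v0 w0)
    (Cop : ℝ → ℝ → Cspace n →L[ℝ] Cspace n)
    (hCop : ∀ (lam ω : ℝ) (u : Cspace n), ∀ x ∈ Set.Icc (0:ℝ) 1, ∀ (t : ℝ) (j : Fin n),
      ev (Cop lam ω u) x t j = d.CopRaw lam ω (ev u) x t j)
    (Fop : ℝ → ℝ → Cspace n → Cspace n)
    (hFop : ∀ (lam ω : ℝ) (u : Cspace n), ∀ x ∈ Set.Icc (0:ℝ) 1, ∀ (t : ℝ) (j : Fin n),
      ev (Fop lam ω u) x t j = d.FopRaw lam ω (ev u) x t j)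
    (DF : ℝ → ℝ → Cspace n → Cspace n →L[ℝ] Cspace n)
    (hDF : ∀ (lam ω : ℝ) (u : Cspace n), HasFDerivAt (Fop lam ω) (DF lam ω u) u)
    (P Q : Cspace n →L[ℝ] Cspace n)
    (hPproj : P.comp P = P) (hQproj : Q.comp Q = Q)
    (hPker : LinearMap.ker P.toLinearMap =
      LinearMap.range (ContinuousLinearMap.id ℝ (Cspace n) - Cop 0 1 - DF 0 1 0).toLinearMap)
    (hQrange : LinearMap.range Q.toLinearMap =
      LinearMap.ker (ContinuousLinearMap.id ℝ (Cspace n) - Cop 0 1 - DF 0 1 0).toLinearMap)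
    (δ1 : ℝ) (hδ1pos : 0 < δ1) (hδ1le : δ1 ≤ δ0)
    (hδ1iso : ∀ lam ∈ Set.Icc (-δ1) δ1, ∀ ω : ℝ,
      Function.Bijective ⇑(ContinuousLinearMap.id ℝ (Cspace n) - Cop lam ω)) :
    ∃ δ2 c2 : ℝ, 0 < δ2 ∧ δ2 < δ1 ∧ 0 < c2 ∧
      ∀ lam ∈ Set.Icc (-δ2) δ2, ∀ ω ∈ Set.Icc (1-δ2) (1+δ2),
        ∀ u : Cspace n, ‖u‖ ≤ δ2 →
          ∀ w ∈ LinearMap.ker Q.toLinearMap,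
            c2 * ‖w‖ ≤ ‖(ContinuousLinearMap.id ℝ (Cspace n) - P)
              ((ContinuousLinearMap.id ℝ (Cspace n) - Cop lam ω - DF lam ω u) w)‖ := by
  obtain ⟨δ, hδ, c, hδ0, hc⟩ := hyp.exists_charCoeffs
  obtain ⟨δ', hδ', hδ'δ, M, hM0, hM⟩ := hc.exists_norm_le_mul_norm_sub hδ hdiss
  have hsub : Icc (-δ') δ' ⊆ Icc (-δ) δ := Icc_subset_Icc (neg_le_neg hδ'δ) hδ'δ
  have hCrefl : ∀ lam ∈ Icc (-δ) δ, ∀ ω (u : Cspace n), ∀ x ∈ Icc (0 : ℝ) 1, ∀ t j,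
      ev (Cop lam ω u) x t j = c.refl lam ω (ev u) x t j := fun lam hl ω u x hx t j => by
    rw [hCop lam ω u x hx, hc.copRaw_eq hl hx]
  have hFvol : ∀ lam ∈ Icc (-δ) δ, ∀ ω (u : Cspace n), ∀ x ∈ Icc (0 : ℝ) 1, ∀ t j,
      ev (DF lam ω 0 u) x t j = c.vol lam ω (ev u) x t j := fun lam hl ω u x hx t j =>
    hc.ev_fderiv_zero_eq_vol hyp hl (hFop lam ω) (hDF lam ω 0) u hx t j
  have hδzero : (0 : ℝ) ∈ Icc (-δ) δ := ⟨by linarith, hδ.le⟩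
  by_contra hcon
  push Not at hcon
  set κ : ℝ := min (min (δ1 / 2) δ') (1 / 2) with hκ
  have hκ0 : 0 < κ := by positivity
  have hκ1 : κ ≤ δ1 / 2 := (min_le_left _ _).trans (min_le_left _ _)
  have hκ' : κ ≤ δ' := (min_le_left _ _).trans (min_le_right _ _)
  have hκ2 : κ ≤ 1 / 2 := min_le_right _ _
  set s : ℕ → ℝ := fun k => κ * (1 / ((k : ℝ) + 1)) with hs
  have hs0 : ∀ k, 0 < s k := fun k => by positivity
  have hsκ : ∀ k, s k ≤ κ := fun k =>
    mul_le_of_le_one_right hκ0.le (by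
      rw [div_le_one (by positivity)]
      linarith [(Nat.cast_nonneg k : (0 : ℝ) ≤ k)])
  have hslim : Tendsto s atTop (𝓝 0) := by
    have := (tendsto_one_div_add_atTop_nhds_zero_nat (𝕜 := ℝ)).const_mul κ
    rwa [mul_zero] at this
  choose lam hlam ω hω u hu w hw hlt using fun k : ℕ =>
    hcon (s k) (1 / ((k : ℝ) + 1)) (hs0 k) (by linarith [hsκ k]) (by positivity)
  have hlam' : ∀ k, lam k ∈ Icc (-δ') δ' := fun k =>
    ⟨by linarith [(hlam k).1, hsκ k], by linarith [(hlam k).2, hsκ k]⟩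
  have hω' : ∀ k, ω k ∈ Icc (1 / 2 : ℝ) (3 / 2) := fun k =>
    ⟨by linarith [(hω k).1, hsκ k], by linarith [(hω k).2, hsκ k]⟩
  have hp : Tendsto (fun k => (lam k, ω k)) atTop (𝓝 ((0 : ℝ), (1 : ℝ))) := by
    refine Tendsto.prodMk_nhds ?_ ?_
    · exact tendsto_of_tendsto_of_tendsto_of_le_of_le (by simpa using hslim.neg) hslim
        (fun k => (hlam k).1) fun k => (hlam k).2
    · exact tendsto_of_tendsto_of_tendsto_of_le_of_le (by simpa using hslim.const_sub 1)
        (by simpa using hslim.const_add 1) (fun k => (hω k).1) fun k => (hω k).2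
  have hwpos : ∀ k, 0 < ‖w k‖ := fun k => by
    by_contra hneg
    have h0 : ‖w k‖ = 0 := le_antisymm (not_lt.1 hneg) (norm_nonneg _)
    have := hlt k
    rw [h0, mul_zero] at this
    exact absurd this (norm_nonneg _).not_gt
  refine false_of_asymptotic_kernel (C := fun k => Cop (lam k) (ω k))
    (F := fun k => DF (lam k) (ω k) 0) (D := fun k => DF (lam k) (ω k) (u k))
    (C0 := Cop 0 1) (F0 := DF 0 1 0) (P := P) (Q := Q) (w := fun k => ‖w k‖⁻¹ • w k)
    (fun z => ?_) (fun z => ?_) ?_ hM0 (fun k z => ?_) (fun h => ?_) (fun R => ?_) (fun R => ?_)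
    (fun z => ?_) (fun z => ?_) (fun z => ?_) (fun z hz => ?_) (fun k => ?_) (fun k => ?_) ?_
  · exact tendsto_of_ev_eq (G := fun p => c.refl p.1 p.2 (ev z))
      (fun j => c.continuous_refl (continuous_ev z) j) hp
      (fun k => hCrefl _ (hsub (hlam' k)) _ z) (hCrefl 0 hδzero 1 z)
  · exact tendsto_of_ev_eq (G := fun p => c.vol p.1 p.2 (ev z))
      (fun j => c.continuous_vol (continuous_ev z) j) hp
      (fun k => hFvol _ (hsub (hlam' k)) _ z) (hFvol 0 hδzero 1 z)
  · rw [Metric.tendsto_nhds]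
    intro ε hε
    obtain ⟨ρ, hρ, H⟩ := hc.exists_norm_fderiv_sub_le hyp (half_pos hε)
    filter_upwards [hslim.eventually (gt_mem_nhds hρ)] with k hk
    rw [Real.dist_eq, sub_zero, abs_norm]
    exact (H _ (hsub (hlam' k)) _ _ (hFop _ _) _ _ _ (hDF _ _ _) (hDF _ _ _)
      ((hu k).trans_lt hk)).trans_lt (half_lt_self hε)
  · exact hM _ (hlam' k) (ω k) _ (hCrefl _ (hsub (hlam' k)) _) z
  · exact (hδ1iso 0 ⟨by linarith, hδ1pos.le⟩ 1).2 h
  · obtain ⟨S, hS, H⟩ := c.exists_isCompact_vol δ R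
    refine ⟨S, hS, fun k y z hz hyz => H _ (hsub (hlam' k)) _ (hω' k) y z _ _ hz hyz
      (fun x hx t j => ?_) (hFvol _ (hsub (hlam' k)) _ _)⟩
    rw [ev_add, Pi.add_apply, hCrefl _ (hsub (hlam' k)) _ y x hx,
      hFvol _ (hsub (hlam' k)) _ z x hx]
  · obtain ⟨S, hS, H⟩ := c.exists_isCompact_vol δ R
    refine ⟨S, hS, fun y z hz hyz => H 0 hδzero 1 (by norm_num) y z _ _ hz hyz
      (fun x hx t j => ?_) (hFvol 0 hδzero 1 _)⟩
    rw [ev_add, Pi.add_apply, hCrefl 0 hδzero 1 y x hx, hFvol 0 hδzero 1 z x hx]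
  · exact DFunLike.congr_fun hPproj z
  · exact DFunLike.congr_fun hQproj z
  · have : (ContinuousLinearMap.id ℝ (Cspace n) - Cop 0 1 - DF 0 1 0) z ∈
        LinearMap.ker P.toLinearMap := hPker ▸ LinearMap.mem_range_self _ z
    exact this
  · have : z ∈ LinearMap.range Q.toLinearMap := hQrange ▸ LinearMap.mem_ker.2 hz
    exact this
  · rw [norm_smul, norm_inv, norm_norm, inv_mul_cancel₀ (hwpos k).ne']
  · rw [map_smul, show Q (w k) = 0 from hw k, smul_zero]
  · refine squeeze_zero_norm (fun k => ?_) (tendsto_one_div_add_atTop_nhds_zero_nat (𝕜 := ℝ))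
    have h1 := hlt k
    set T := (ContinuousLinearMap.id ℝ (Cspace n) - P).comp
      (ContinuousLinearMap.id ℝ (Cspace n) - Cop (lam k) (ω k) - DF (lam k) (ω k) (u k))
    have h2 : ‖T (‖w k‖⁻¹ • w k)‖ ≤ 1 / ((k : ℝ) + 1) := by
      rw [map_smul, norm_smul, norm_inv, norm_norm, inv_mul_le_iff₀ (hwpos k)]
      exact h1.le.trans (le_of_eq (mul_comm _ _))
    exact h2
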